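/- Let (Q, W) arise from a non-degenerate brane tiling satisfying the first consistency condition, with periodic quiver Q̃. Then the following conditions are equivalent: (1) for every shortest path u in Q̃ (between its endpoints) there exists an arrow a with t(a) = s(u) such that ua is also a shortest path; (2) if w is a weak path in Q̃ (or in Q) such that wa is weakly equivalent to a strict path for every arrow a with t(a) = s(w), then w itself is weakly equivalent to a strict path. -/

import Mathlib

open scoped Classical

noncomputable section

/-- A quiver, given by a vertex set, an arrow set, and source/target maps. -/
structure Quiv where
  V : Type
  A : Type
  src : A → V
  tgt : A → V

namespace Quiv

/-- Strict paths in a quiver: `Path Q i j` is the type of (directed) paths from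
`i` to `j`, built by prepending arrows. -/
inductive Path (Q : Quiv) : Q.V → Q.V → Type
  | nil (i : Q.V) : Path Q i i
  | cons {j : Q.V} (a : Q.A) (p : Path Q (Q.tgt a) j) : Path Q (Q.src a) j

namespace Path

variable {Q : Quiv}

/-- Composition of paths; `p.comp q` traverses `p` first and then `q`.
(In the algebraic right-to-left notation this is the product `q·p`.) -/
def comp : ∀ {i j k : Q.V}, Path Q i j → Path Q j k → Path Q i k
  | _, _, _, .nil _, q => q
  | _, _, _, .cons a p, q => .cons a (p.comp q)

/-- The path consisting of a single arrow. -/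
def single (a : Q.A) : Path Q (Q.src a) (Q.tgt a) := .cons a (.nil _)

/-- Transport a path along equalities of its endpoints. -/
def cast {i i' j j' : Q.V} (hi : i = i') (hj : j = j') (p : Path Q i j) :
    Path Q i' j' := by
  cases hi; cases hj; exact p

/-- The list of arrows traversed by a path (in order of traversal). -/
def arrows : ∀ {i j : Q.V}, Path Q i j → List Q.A
  | _, _, .nil _ => []
  | _, _, .cons a p => a :: p.arrows

/-- The content of a path: for each arrow, the multiplicity with which it occurs. -/
def content : ∀ {i j : Q.V}, Path Q i j → (Q.A → ℤ)
  | _, _, .nil _ => 0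
  | _, _, .cons a p => (fun b => if b = a then 1 else 0) + p.content

end Path

/-- Weak paths in a quiver: formal composites of arrows (`fwd`) and inverses of
arrows (`bwd`). -/
inductive WPath (Q : Quiv) : Q.V → Q.V → Type
  | nil (i : Q.V) : WPath Q i i
  | fwd {j : Q.V} (a : Q.A) (p : WPath Q (Q.tgt a) j) : WPath Q (Q.src a) j
  | bwd {j : Q.V} (a : Q.A) (p : WPath Q (Q.src a) j) : WPath Q (Q.tgt a) j

namespace WPath

variable {Q : Quiv}

/-- Composition of weak paths: `p.comp q` traverses `p` first and then `q`. -/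
def comp : ∀ {i j k : Q.V}, WPath Q i j → WPath Q j k → WPath Q i k
  | _, _, _, .nil _, q => q
  | _, _, _, .fwd a p, q => .fwd a (p.comp q)
  | _, _, _, .bwd a p, q => .bwd a (p.comp q)

/-- Transport a weak path along equalities of its endpoints. -/
def cast {i i' j j' : Q.V} (hi : i = i') (hj : j = j') (p : WPath Q i j) :
    WPath Q i' j' := by
  cases hi; cases hj; exact p

/-- The formal inverse of a weak path. -/
def reverse : ∀ {i j : Q.V}, WPath Q i j → WPath Q j i
  | _, _, .nil i => .nil i
  | _, _, .fwd a p => p.reverse.comp (.bwd a (.nil _))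
  | _, _, .bwd a p => p.reverse.comp (.fwd a (.nil _))

/-- The content of a weak path: each arrow is counted with `+1`, each inverse
arrow with `-1`. -/
def content : ∀ {i j : Q.V}, WPath Q i j → (Q.A → ℤ)
  | _, _, .nil _ => 0
  | _, _, .fwd a p => (fun b => if b = a then 1 else 0) + p.content
  | _, _, .bwd a p => (fun b => if b = a then -1 else 0) + p.content

/-- Natural number powers of a weak cycle. -/
def npow {i : Q.V} (c : WPath Q i i) : ℕ → WPath Q i i
  | 0 => .nil i
  | n + 1 => c.comp (npow c n)

/-- Integer powers of a weak cycle. -/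
def zpow {i : Q.V} (c : WPath Q i i) (k : ℤ) : WPath Q i i :=
  if 0 ≤ k then c.npow k.toNat else c.reverse.npow (-k).toNat

end WPath

/-- The weak path underlying a strict path. -/
def Path.toWeak {Q : Quiv} : ∀ {i j : Q.V}, Path Q i j → WPath Q i j
  | _, _, .nil i => .nil i
  | _, _, .cons a p => .fwd a p.toWeak

/-- A morphism of quivers. -/
structure Hom (Q Q' : Quiv) where
  onV : Q.V → Q'.V
  onA : Q.A → Q'.A
  src_comm : ∀ a, Q'.src (onA a) = onV (Q.src a)
  tgt_comm : ∀ a, Q'.tgt (onA a) = onV (Q.tgt a)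

/-- The image of a strict path under a morphism of quivers. -/
def Path.map {Q Q' : Quiv} (φ : Hom Q Q') :
    ∀ {i j : Q.V}, Path Q i j → Path Q' (φ.onV i) (φ.onV j)
  | _, _, .nil i => .nil _
  | _, _, .cons a p =>
      ((((Path.single (φ.onA a)).cast rfl (φ.tgt_comm a)).comp (p.map φ)).cast
        (φ.src_comm a) rfl)

/-- The image of a weak path under a morphism of quivers. -/
def WPath.map {Q Q' : Quiv} (φ : Hom Q Q') :
    ∀ {i j : Q.V}, WPath Q i j → WPath Q' (φ.onV i) (φ.onV j)
  | _, _, .nil i => .nil _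
  | _, _, .fwd a p =>
      ((WPath.fwd (φ.onA a) ((p.map φ).cast (φ.tgt_comm a).symm rfl)).cast
        (φ.src_comm a) rfl)
  | _, _, .bwd a p =>
      ((WPath.bwd (φ.onA a) ((p.map φ).cast (φ.src_comm a).symm rfl)).cast
        (φ.tgt_comm a) rfl)

/-- The smallest equivalence relation on strict paths which contains `R` and is
stable under pre- and post-composition with strict paths. -/
inductive PEquiv (Q : Quiv) (R : ∀ ⦃i j : Q.V⦄, Path Q i j → Path Q i j → Prop) :
    ∀ ⦃i j : Q.V⦄, Path Q i j → Path Q i j → Prop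
  | base {i j : Q.V} {p q : Path Q i j} : R p q → PEquiv Q R p q
  | refl {i j : Q.V} (p : Path Q i j) : PEquiv Q R p p
  | symm {i j : Q.V} {p q : Path Q i j} : PEquiv Q R p q → PEquiv Q R q p
  | trans {i j : Q.V} {p q r : Path Q i j} :
      PEquiv Q R p q → PEquiv Q R q r → PEquiv Q R p r
  | comp {i j k l : Q.V} (u : Path Q i j) {p q : Path Q j k} (v : Path Q k l) :
      PEquiv Q R p q → PEquiv Q R (u.comp (p.comp v)) (u.comp (q.comp v))

/-- The smallest equivalence relation on weak paths which contains `R`, contains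
the cancellation relations `a a⁻¹ ∼ 1 ∼ a⁻¹ a`, and is stable under pre- and
post-composition with weak paths. -/
inductive WEquiv (Q : Quiv) (R : ∀ ⦃i j : Q.V⦄, WPath Q i j → WPath Q i j → Prop) :
    ∀ ⦃i j : Q.V⦄, WPath Q i j → WPath Q i j → Prop
  | base {i j : Q.V} {p q : WPath Q i j} : R p q → WEquiv Q R p q
  | cancel_fwd (a : Q.A) :
      WEquiv Q R (WPath.fwd a (WPath.bwd a (WPath.nil _))) (WPath.nil _)
  | cancel_bwd (a : Q.A) :
      WEquiv Q R (WPath.bwd a (WPath.fwd a (WPath.nil _))) (WPath.nil _)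
  | refl {i j : Q.V} (p : WPath Q i j) : WEquiv Q R p p
  | symm {i j : Q.V} {p q : WPath Q i j} : WEquiv Q R p q → WEquiv Q R q p
  | trans {i j : Q.V} {p q r : WPath Q i j} :
      WEquiv Q R p q → WEquiv Q R q r → WEquiv Q R p r
  | comp {i j k l : Q.V} (u : WPath Q i j) {p q : WPath Q j k} (v : WPath Q k l) :
      WEquiv Q R p q → WEquiv Q R (u.comp (p.comp v)) (u.comp (q.comp v))

end Quiv

open Quiv

/-- A brane tiling, encoded through its dual quiver together with its face
structure.  For each arrow `a`, `wface true a` (resp. `wface false a`) is the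
complementary path of `a` in the unique positive (resp. negative) face
containing `a`, so that the boundary cycle of that face based at `Q.src a` is
`a` followed by `wface s a`.  The field `rot` expresses that the face cycles
are compatible with rotation, i.e. that the faces are genuine cyclic faces. -/
structure BraneTiling where
  Q : Quiv
  fintV : Fintype Q.V
  fintA : Fintype Q.A
  wface : Bool → ∀ a : Q.A, Quiv.Path Q (Q.tgt a) (Q.src a)
  rot : ∀ (s : Bool) (a b : Q.A) (p : Quiv.Path Q (Q.tgt b) (Q.src a)),
    HEq (wface s a) (Quiv.Path.cons b p) →
      HEq (wface s b) (p.comp (Quiv.Path.single a))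

attribute [instance] BraneTiling.fintV BraneTiling.fintA

namespace BraneTiling

variable (B : BraneTiling)

/-- The boundary cycle, based at `Q.src a`, of the positive (`s = true`) or
negative (`s = false`) face containing the arrow `a`. -/
def faceCycle (s : Bool) (a : B.Q.A) : Path B.Q (B.Q.src a) (B.Q.src a) :=
  Path.cons a (B.wface s a)

/-- `d₂(F)` for the face of sign `s` through `a`: the content of its boundary. -/
def faceContent (s : Bool) (a : B.Q.A) : B.Q.A → ℤ := (B.faceCycle s a).content

/-- The list of arrows on the boundary of the face of sign `s` through `a`. -/
def cycleArrows (s : Bool) (a : B.Q.A) : List B.Q.A := (B.faceCycle s a).arrows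

/-- A perfect matching (of the bipartite graph dual to the quiver): a set of
arrows such that every face contains exactly one arrow of the set. -/
def IsMatching (S : Set B.Q.A) : Prop :=
  ∀ (s : Bool) (a : B.Q.A),
    (B.cycleArrows s a).countP (fun x => decide (x ∈ S)) = 1

/-- The brane tiling is non-degenerate if every edge belongs to some perfect
matching. -/
def NonDegenerate : Prop :=
  ∀ a : B.Q.A, ∃ S : Set B.Q.A, B.IsMatching S ∧ a ∈ S

/-- The subgroup of `ℤ^{Q₁}` generated by the differences `d₂(F) - d₂(F')` of
the contents of faces. -/
def lamRel : Submodule ℤ (B.Q.A → ℤ) :=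
  Submodule.span ℤ
    {x | ∃ (s : Bool) (a : B.Q.A) (t : Bool) (b : B.Q.A),
      x = B.faceContent s a - B.faceContent t b}

/-- The weight group `Λ = ℤ^{Q₁} / ⟨d₂(F) - d₂(F') : F, F' ∈ Q₂⟩`. -/
def Lam : Type := (B.Q.A → ℤ) ⧸ B.lamRel

instance : AddCommGroup B.Lam := by unfold Lam; infer_instance
instance : Module ℤ B.Lam := by unfold Lam; infer_instance

/-- The weight function `ℤ^{Q₁} → Λ` (the canonical projection). -/
def wt : (B.Q.A → ℤ) →ₗ[ℤ] B.Lam := B.lamRel.mkQ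

/-- The weight of a strict path. -/
def wtP {i j : B.Q.V} (p : Path B.Q i j) : B.Lam := B.wt p.content

/-- The weight of a weak path. -/
def wtW {i j : B.Q.V} (p : WPath B.Q i j) : B.Lam := B.wt p.content

/-- The weight of an arrow. -/
def wtA (a : B.Q.A) : B.Lam := B.wt ((Path.single a).content)

/-- The weight `ω̄` of a face cycle (in `Λ` it does not depend on the face). -/
def omegaBarAt (a : B.Q.A) : B.Lam := B.wt (B.faceContent true a)

end BraneTiling
namespace BraneTiling

variable (B : BraneTiling)

/-- The relations `∂W/∂a`: for each arrow `a`, the complementary path of `a` in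
its positive face is identified with the complementary path of `a` in its
negative face. -/
inductive dWRel : ∀ ⦃i j : B.Q.V⦄, Path B.Q i j → Path B.Q i j → Prop
  | mk (a : B.Q.A) : dWRel (B.wface true a) (B.wface false a)

/-- The relations `∂W/∂a`, viewed on weak paths. -/
inductive dWRelW : ∀ ⦃i j : B.Q.V⦄, WPath B.Q i j → WPath B.Q i j → Prop
  | mk (a : B.Q.A) : dWRelW ((B.wface true a).toWeak) ((B.wface false a).toWeak)

/-- Strict equivalence of paths: the equivalence relation `(∂W)` on strict paths. -/
def SEquiv : ∀ ⦃i j : B.Q.V⦄, Path B.Q i j → Path B.Q i j → Prop :=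
  PEquiv B.Q B.dWRel

/-- Weak equivalence of weak paths in `Q`. -/
def WkEquiv : ∀ ⦃i j : B.Q.V⦄, WPath B.Q i j → WPath B.Q i j → Prop :=
  WEquiv B.Q B.dWRelW

end BraneTiling

/-- The periodic quiver `Q̃` of a brane tiling: the inverse image of the quiver
`Q` in the universal cover of the torus, encoded as a covering of quivers with
unique lifting of arrows, together with the lifted face structure. -/
structure Periodic (B : BraneTiling) where
  tQ : Quiv
  proj : Quiv.Hom tQ B.Q
  liftSrc : ∀ (a : B.Q.A) (i : tQ.V), proj.onV i = B.Q.src a →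
    ∃! a' : tQ.A, proj.onA a' = a ∧ tQ.src a' = i
  liftTgt : ∀ (a : B.Q.A) (i : tQ.V), proj.onV i = B.Q.tgt a →
    ∃! a' : tQ.A, proj.onA a' = a ∧ tQ.tgt a' = i
  surjV : Function.Surjective proj.onV
  twface : Bool → ∀ a : tQ.A, Quiv.Path tQ (tQ.tgt a) (tQ.src a)
  proj_twface : ∀ (s : Bool) (a : tQ.A),
    (twface s a).map proj =
      (B.wface s (proj.onA a)).cast (proj.tgt_comm a) (proj.src_comm a)

namespace Periodic

variable {B : BraneTiling} (P : Periodic B)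

/-- The boundary cycle, based at `src a`, of the face of sign `s` of the
periodic quiver containing the arrow `a`. -/
def faceCycle (s : Bool) (a : P.tQ.A) : Path P.tQ (P.tQ.src a) (P.tQ.src a) :=
  Path.cons a (P.twface s a)

/-- Pairs of boundary cycles of faces of the periodic quiver with the same
endpoints. -/
inductive faceRel : ∀ ⦃i j : P.tQ.V⦄, WPath P.tQ i j → WPath P.tQ i j → Prop
  | mk (s t : Bool) (a b : P.tQ.A) (h : P.tQ.src b = P.tQ.src a) :
      faceRel ((P.faceCycle s a).toWeak) (((P.faceCycle t b).toWeak).cast h h)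

/-- Weak equivalence of weak paths in the periodic quiver: the equivalence
relation generated by identifying any two boundary cycles of faces with the
same endpoints (stable under composition). -/
def WkEquiv : ∀ ⦃i j : P.tQ.V⦄, WPath P.tQ i j → WPath P.tQ i j → Prop :=
  WEquiv P.tQ P.faceRel

/-- The weight of a weak path of the periodic quiver. -/
def wtW {i j : P.tQ.V} (u : WPath P.tQ i j) : B.Lam := B.wt ((u.map P.proj).content)

/-- The weight of a strict path of the periodic quiver. -/
def wtP {i j : P.tQ.V} (u : Path P.tQ i j) : B.Lam := B.wt ((u.map P.proj).content)

/-- A strict path `u : i → j` of the periodic quiver is a shortest path if any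
strict path from `i` to `j` is weakly equivalent to `u ω^k` for some `k ≥ 0`. -/
def Shortest {i j : P.tQ.V} (u : Path P.tQ i j) : Prop :=
  ∀ p : Path P.tQ i j, ∃ (s : Bool) (a : P.tQ.A) (h : P.tQ.src a = i) (k : ℕ),
    P.WkEquiv p.toWeak
      (((((P.faceCycle s a).toWeak).npow k).cast h h).comp u.toWeak)

end Periodic

/-- The first consistency condition: two paths in `Q` with the same startpoint
are strictly equivalent if and only if their weights are equal. -/
def BraneTiling.Consistent1 (B : BraneTiling) : Prop :=
  ∀ (i j j' : B.Q.V) (u : Path B.Q i j) (v : Path B.Q i j'),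
    (∃ h : j = j', B.SEquiv (u.cast rfl h) v) ↔ B.wtP u = B.wtP v

namespace Quiv

namespace Path

variable {Q : Quiv}

theorem arrows_comp : ∀ {i j k : Q.V} (p : Path Q i j) (q : Path Q j k),
    (p.comp q).arrows = p.arrows ++ q.arrows
  | _, _, _, .nil _, q => rfl
  | _, _, _, .cons a p, q => by simp [comp, arrows, arrows_comp p q]

theorem arrows_single (a : Q.A) : (single a).arrows = [a] := rfl

theorem arrows_cast {i i' j j' : Q.V} (hi : i = i') (hj : j = j') (p : Path Q i j) :
    (p.cast hi hj).arrows = p.arrows := by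
  subst hi hj; rfl

theorem cast_heq {i i' j j' : Q.V} (hi : i = i') (hj : j = j') (p : Path Q i j) :
    HEq (p.cast hi hj) p := by
  subst hi hj; rfl

theorem arrows_eq_of_heq {i j j' : Q.V} (h : j = j') {p : Path Q i j} {q : Path Q i j'}
    (hpq : HEq p q) : p.arrows = q.arrows := by
  subst h; rw [eq_of_heq hpq]

theorem content_eq_count : ∀ {i j : Q.V} (p : Path Q i j) (b : Q.A),
    p.content b = (p.arrows.count b : ℤ)
  | _, _, .nil _, b => by simp [content, arrows]
  | _, _, .cons a p, b => by
    simp only [content, arrows, Pi.add_apply, content_eq_count p b, List.count_cons, beq_iff_eq,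
      eq_comm (a := a)]
    split_ifs <;> push_cast <;> ring

theorem eq_endpoints_of_arrows_eq_nil {i j : Q.V} (p : Path Q i j) (h : p.arrows = []) :
    i = j := by
  cases p with
  | nil => rfl
  | cons a p => simp [arrows] at h

theorem exists_eq_cons {i j : Q.V} (p : Path Q i j) {a : Q.A} {l : List Q.A}
    (h : p.arrows = a :: l) :
    ∃ (e : Q.src a = i) (q : Path Q (Q.tgt a) j), q.arrows = l ∧ p = (cons a q).cast e rfl := by
  cases p with
  | nil => simp [arrows] at h
  | cons b p =>
    simp only [arrows, List.cons.injEq] at h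
    obtain ⟨rfl, rfl⟩ := h
    exact ⟨rfl, p, rfl, rfl⟩

theorem exists_eq_comp {i j : Q.V} (p : Path Q i j) {l₁ l₂ : List Q.A}
    (h : p.arrows = l₁ ++ l₂) :
    ∃ (k : Q.V) (u : Path Q i k) (v : Path Q k j),
      u.arrows = l₁ ∧ v.arrows = l₂ ∧ p = u.comp v := by
  induction l₁ generalizing i with
  | nil => exact ⟨i, .nil i, p, rfl, h, rfl⟩
  | cons a l ih =>
    obtain ⟨rfl, q, hq, rfl⟩ := p.exists_eq_cons h
    obtain ⟨k, u, v, rfl, rfl, rfl⟩ := ih q hq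
    exact ⟨k, .cons a u, v, rfl, rfl, rfl⟩

theorem arrows_map {Q' : Quiv} (φ : Hom Q Q') : ∀ {i j : Q.V} (p : Path Q i j),
    (p.map φ).arrows = p.arrows.map φ.onA
  | _, _, .nil _ => rfl
  | _, _, .cons a p => by
    simp [map, arrows_cast, arrows_comp, arrows_single, arrows, arrows_map φ p]

theorem comp_toWeak : ∀ {i j k : Q.V} (p : Path Q i j) (q : Path Q j k),
    (p.comp q).toWeak = p.toWeak.comp q.toWeak
  | _, _, _, .nil _, q => rfl
  | _, _, _, .cons a p, q => by simp [comp, toWeak, WPath.comp, comp_toWeak p q]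

end Path

namespace WPath

variable {Q : Quiv}

theorem comp_nil : ∀ {i j : Q.V} (p : WPath Q i j), p.comp (.nil j) = p
  | _, _, .nil _ => rfl
  | _, _, .fwd a p => by rw [comp, comp_nil p]
  | _, _, .bwd a p => by rw [comp, comp_nil p]

theorem comp_assoc : ∀ {i j k l : Q.V} (p : WPath Q i j) (q : WPath Q j k) (r : WPath Q k l),
    (p.comp q).comp r = p.comp (q.comp r)
  | _, _, _, _, .nil _, q, r => rfl
  | _, _, _, _, .fwd a p, q, r => by simp [comp, comp_assoc p q r]
  | _, _, _, _, .bwd a p, q, r => by simp [comp, comp_assoc p q r]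

theorem content_cast {i i' j j' : Q.V} (hi : i = i') (hj : j = j') (p : WPath Q i j) :
    (p.cast hi hj).content = p.content := by
  subst hi hj; rfl

end WPath

namespace WEquiv

variable {Q : Quiv} {R : ∀ ⦃i j : Q.V⦄, WPath Q i j → WPath Q i j → Prop}

theorem comp_left {i j k : Q.V} (u : WPath Q i j) {p q : WPath Q j k} (h : WEquiv Q R p q) :
    WEquiv Q R (u.comp p) (u.comp q) := by
  simpa only [WPath.comp_nil] using WEquiv.comp u (.nil k) h

theorem comp_right {i j k : Q.V} {p q : WPath Q i j} (v : WPath Q j k) (h : WEquiv Q R p q) :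
    WEquiv Q R (p.comp v) (q.comp v) :=
  WEquiv.comp (.nil i) v h

theorem of_fwd {j : Q.V} (a : Q.A) {p q : WPath Q (Q.tgt a) j}
    (h : WEquiv Q R (.fwd a p) (.fwd a q)) : WEquiv Q R p q :=
  ((WEquiv.cancel_bwd a).comp_right p).symm.trans
    ((h.comp_left (.bwd a (.nil _))).trans ((WEquiv.cancel_bwd a).comp_right q))

theorem of_comp_left : ∀ {i j k : Q.V} (c : Path Q i j) {p q : WPath Q j k},
    WEquiv Q R (c.toWeak.comp p) (c.toWeak.comp q) → WEquiv Q R p q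
  | _, _, _, .nil _, _, _, h => h
  | _, _, _, .cons a c, _, _, h => of_comp_left c (of_fwd a h)

end WEquiv

end Quiv

section Flags

variable {A M : Type} [AddCommGroup M] (m : A → M)

/-- The arrows of a path together with the positions of their sources, where the
path starts at position `x` and the arrow `a` changes the position by `m a`. -/
def flags : List A → M → List (A × M)
  | [], _ => []
  | a :: l, x => (a, x) :: flags l (x + m a)

theorem flags_append (l₁ l₂ : List A) (x : M) :
    flags m (l₁ ++ l₂) x = flags m l₁ x ++ flags m l₂ (x + (l₁.map m).sum) := by
  induction l₁ generalizing x with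
  | nil => simp [flags]
  | cons a l ih => simp [flags, ih, add_assoc]

theorem map_fst_flags (l : List A) (x : M) : (flags m l x).map Prod.fst = l := by
  induction l generalizing x with
  | nil => rfl
  | cons a l ih => simp [flags, ih]

theorem exists_of_mem_flags {l : List A} {x : M} {z : A × M} (h : z ∈ flags m l x) :
    ∃ l₁ l₂, l = l₁ ++ z.1 :: l₂ ∧ z.2 = x + (l₁.map m).sum := by
  induction l generalizing x with
  | nil => simp [flags] at h
  | cons a l ih =>
    rcases List.mem_cons.1 h with rfl | h
    · exact ⟨[], l, by simp⟩
    · obtain ⟨l₁, l₂, rfl, h₂⟩ := ih h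
      exact ⟨a :: l₁, l₂, rfl, by simp [h₂, add_assoc]⟩

/-- The multiplicities of the flags of a path. -/
def flagCount (l : List A) (x : M) (z : A × M) : ℤ := ((flags m l x).count z : ℤ)

theorem flagCount_append (l₁ l₂ : List A) (x : M) :
    flagCount m (l₁ ++ l₂) x = flagCount m l₁ x + flagCount m l₂ (x + (l₁.map m).sum) := by
  funext z; simp [flagCount, flags_append]

theorem flagCount_cons (a : A) (l : List A) (x : M) :
    flagCount m (a :: l) x = flagCount m [a] x + flagCount m l (x + m a) := by
  simpa using flagCount_append m [a] l x

theorem flagCount_eq_zero {l : List A} {x : M} {z : A × M} (h : z ∉ flags m l x) :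
    flagCount m l x z = 0 := by
  simp [flagCount, List.count_eq_zero.2 h]

theorem finite_support_flagCount (l : List A) (x : M) :
    (Function.support (flagCount m l x)).Finite := by
  refine (flags m l x).finite_toSet.subset fun z hz => ?_
  by_contra hz'
  exact hz (flagCount_eq_zero m hz')

end Flags

namespace BraneTiling

variable {B : BraneTiling}

theorem arrows_wface_of_eq_cons {s : Bool} {a b : B.Q.A} {l : List B.Q.A}
    (h : (B.wface s a).arrows = b :: l) : (B.wface s b).arrows = l ++ [a] := by
  obtain ⟨e, q, rfl, hq⟩ := (B.wface s a).exists_eq_cons h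
  have hh : HEq (B.wface s a) (Path.cons b q) := by
    rw [hq]; exact Path.cast_heq e rfl _
  rw [Path.arrows_eq_of_heq e (B.rot s a b q hh), Path.arrows_comp, Path.arrows_single]

theorem cycleArrows_eq (s : Bool) (a : B.Q.A) :
    B.cycleArrows s a = a :: (B.wface s a).arrows := rfl

theorem cycleArrows_eq_append {s : Bool} {a c : B.Q.A} {p q : List B.Q.A}
    (h : B.cycleArrows s a = p ++ c :: q) : B.cycleArrows s c = c :: q ++ p := by
  induction p using List.reverseRecOn generalizing c q with
  | nil =>
    obtain ⟨rfl, rfl⟩ := List.cons.inj h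
    simp [cycleArrows_eq]
  | append_singleton p e ih =>
    have := ih (c := e) (q := c :: q) (by simpa using h)
    rw [cycleArrows_eq, List.cons_append, List.cons.injEq] at this
    rw [cycleArrows_eq, arrows_wface_of_eq_cons (l := q ++ p) (a := e) (by simpa using this.2)]
    simp

/-- The arrow following `a` on the boundary of the face of sign `s` through `a`. -/
def next (B : BraneTiling) (s : Bool) (a : B.Q.A) : B.Q.A := (B.wface s a).arrows.headD a

theorem cycleArrows_next (s : Bool) (a : B.Q.A) :
    B.cycleArrows s (B.next s a) = (B.wface s a).arrows ++ [a] := by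
  unfold next
  rcases h : (B.wface s a).arrows with _ | ⟨b, l⟩
  · simp [cycleArrows_eq, h]
  · simp [cycleArrows_eq, arrows_wface_of_eq_cons h]

theorem next_injective (s : Bool) : Function.Injective (B.next s) := by
  intro a b h
  have := cycleArrows_next (B := B) s a
  rw [h, cycleArrows_next] at this
  exact (List.append_inj' this rfl).2 |> fun h => (List.cons.inj h).1.symm

theorem src_next (s : Bool) (a : B.Q.A) : B.Q.src (B.next s a) = B.Q.tgt a := by
  unfold next
  rcases h : (B.wface s a).arrows with _ | ⟨b, l⟩
  · exact (Path.eq_endpoints_of_arrows_eq_nil _ h).symm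
  · exact ((B.wface s a).exists_eq_cons h).1

/-- The permutation `a ↦ B.next s a` of the arrows. -/
def nextEquiv (B : BraneTiling) (s : Bool) : Equiv.Perm B.Q.A :=
  Equiv.ofBijective _ (Finite.injective_iff_bijective.1 (next_injective s))

theorem map_flags_cycleArrows {M : Type} [AddCommGroup M] (m : B.Q.A → M) {s : Bool} {a c : B.Q.A}
    {p q : List B.Q.A} (h : B.cycleArrows s a = p ++ c :: q) (x : M) :
    (flags m (c :: q) x).map (fun z => (B.next s z.1, z.2 + m z.1)) =
      flags m (q ++ [a]) (x + m c) := by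
  induction q generalizing p c x with
  | nil =>
    have hc := cycleArrows_eq_append h
    have : B.next s c = a := by
      rw [cycleArrows_eq, List.cons_append, List.cons.injEq] at hc
      rw [next, hc.2]
      rcases p with _ | ⟨d, p⟩
      · exact (List.cons.inj h).1.symm
      · exact (List.cons.inj h).1.symm
    simp [flags, this]
  | cons d q ih =>
    have hc := cycleArrows_eq_append h
    have : B.next s c = d := by
      rw [cycleArrows_eq, List.cons_append, List.cons.injEq] at hc
      rw [next, hc.2]; rfl
    have ih := ih (p := p ++ [c]) (c := d) (by simpa using h) (x + m c)
    rw [flags, List.map_cons, ih]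
    simp [flags, this]

theorem map_next_cycleArrows (s : Bool) (a : B.Q.A) :
    (B.cycleArrows s a).map (B.next s) = (B.wface s a).arrows ++ [a] := by
  have := congrArg (List.map Prod.fst)
    (map_flags_cycleArrows (B := B) (fun _ => (0 : ℤ)) (s := s) (a := a) (p := []) rfl 0)
  rw [map_fst_flags, List.map_map] at this
  rw [← this, ← map_fst_flags (fun _ => (0 : ℤ)) (B.cycleArrows s a) 0, List.map_map]
  rfl

theorem count_next_cycleArrows (s : Bool) (a b : B.Q.A) :
    (B.cycleArrows s a).count (B.next s b) = (B.cycleArrows s a).count b := by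
  rw [← List.count_map_of_injective (B.cycleArrows s a) (B.next s) (next_injective s) b,
    map_next_cycleArrows]
  exact ((List.perm_append_singleton a (B.wface s a).arrows).count_eq _).symm

theorem flagCount_next_cycleArrows {M : Type} [AddCommGroup M] (m : B.Q.A → M) {s : Bool}
    {a : B.Q.A} (h : ((B.cycleArrows s a).map m).sum = 0) (x : M) (b : B.Q.A) (y : M) :
    flagCount m (B.cycleArrows s a) x (B.next s b, y + m b) =
      flagCount m (B.cycleArrows s a) x (b, y) := by
  have hinj : Function.Injective (fun z : B.Q.A × M => (B.next s z.1, z.2 + m z.1)) := by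
    rintro ⟨a, x⟩ ⟨b, y⟩ h
    obtain ⟨h₁, h₂⟩ := Prod.mk.inj h
    obtain rfl := next_injective s h₁
    simpa using h₂
  unfold flagCount
  rw [← List.count_map_of_injective (flags m (B.cycleArrows s a) x) _ hinj (b, y),
    cycleArrows_eq, map_flags_cycleArrows m (s := s) (a := a) (p := []) rfl, flags_append]
  rw [cycleArrows_eq, List.map_cons, List.sum_cons] at h
  rw [add_assoc, h, add_zero]
  congr 1
  exact List.Perm.count_eq (List.perm_append_singleton (a, x) _).symm _

end BraneTiling

namespace BraneTiling

variable {B : BraneTiling}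

theorem faceContent_eq_count (s : Bool) (a b : B.Q.A) :
    B.faceContent s a b = ((B.cycleArrows s a).count b : ℤ) :=
  Path.content_eq_count _ _

/-- The weight of a face cycle. -/
def omega (B : BraneTiling) : B.Lam :=
  if h : Nonempty B.Q.A then B.omegaBarAt h.some else 0

theorem wt_faceContent (s : Bool) (a : B.Q.A) : B.wt (B.faceContent s a) = B.omega := by
  have h : Nonempty B.Q.A := ⟨a⟩
  rw [omega, dif_pos h]
  exact (Submodule.Quotient.eq _).2 (Submodule.subset_span ⟨s, a, true, h.some, rfl⟩)

/-- The weight of a list of arrows. -/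
def wtL (B : BraneTiling) (l : List B.Q.A) : B.Lam := (l.map B.wtA).sum

theorem wtL_append (l₁ l₂ : List B.Q.A) : B.wtL (l₁ ++ l₂) = B.wtL l₁ + B.wtL l₂ := by
  simp [wtL]

theorem wtL_cons (a : B.Q.A) (l : List B.Q.A) : B.wtL (a :: l) = B.wtA a + B.wtL l := by
  simp [wtL]

theorem wtL_nil : B.wtL [] = 0 := rfl

theorem wtP_eq_wtL : ∀ {i j : B.Q.V} (p : Path B.Q i j), B.wtP p = B.wtL p.arrows
  | _, _, .nil _ => map_zero B.wt
  | _, _, .cons a p => by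
    rw [Path.arrows, wtL_cons, ← wtP_eq_wtL p, wtP, Path.content, map_add, wtA, Path.single,
      Path.content, Path.content, add_zero, wtP]

theorem wtP_comp {i j k : B.Q.V} (p : Path B.Q i j) (q : Path B.Q j k) :
    B.wtP (p.comp q) = B.wtP p + B.wtP q := by
  simp only [wtP_eq_wtL, Path.arrows_comp, wtL_append]

theorem wtP_cast {i i' j j' : B.Q.V} (hi : i = i') (hj : j = j') (p : Path B.Q i j) :
    B.wtP (p.cast hi hj) = B.wtP p := by
  subst hi hj; rfl

theorem wtP_cons {j : B.Q.V} (a : B.Q.A) (p : Path B.Q (B.Q.tgt a) j) :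
    B.wtP (.cons a p) = B.wtA a + B.wtP p := by
  simp only [wtP_eq_wtL, Path.arrows, wtL_cons]

theorem wtP_wface (s : Bool) (a : B.Q.A) : B.wtP (B.wface s a) = B.omega - B.wtA a := by
  rw [eq_sub_iff_add_eq, add_comm, ← wtP_cons]
  exact wt_faceContent s a

/-- The degree on the weight group defined by a perfect matching. -/
def degree {S : Set B.Q.A} (hS : B.IsMatching S) : B.Lam →ₗ[ℤ] ℤ :=
  B.lamRel.liftQ (∑ a with a ∈ S, LinearMap.proj a) <| by
    have key (s : Bool) (a : B.Q.A) :
        (∑ a with a ∈ S, (LinearMap.proj a : (B.Q.A → ℤ) →ₗ[ℤ] ℤ)) (B.faceContent s a) = 1 := by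
      simp only [LinearMap.sum_apply, LinearMap.proj_apply, faceContent_eq_count]
      rw [← Nat.cast_one (R := ℤ), ← hS s a, ← Nat.cast_sum]
      congr 1
      generalize B.cycleArrows s a = l
      induction l with
      | nil => simp
      | cons b l ih =>
        simp [List.count_cons, List.countP_cons, Finset.sum_add_distrib, ih]
    rw [lamRel, Submodule.span_le]
    rintro _ ⟨s, a, t, b, rfl⟩
    simp only [SetLike.mem_coe, LinearMap.mem_ker, map_sub, key, sub_self]

theorem degree_wt {S : Set B.Q.A} (hS : B.IsMatching S) (x : B.Q.A → ℤ) :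
    degree hS (B.wt x) = ∑ a with a ∈ S, x a := by
  exact (B.lamRel.liftQ_apply _ _).trans (by simp)

theorem degree_wtA {S : Set B.Q.A} (hS : B.IsMatching S) (a : B.Q.A) :
    degree hS (B.wtA a) = if a ∈ S then 1 else 0 := by
  simp [wtA, degree_wt, Path.single, Path.content]

theorem degree_wtL {S : Set B.Q.A} (hS : B.IsMatching S) (l : List B.Q.A) :
    degree hS (B.wtL l) = (l.countP (fun x => decide (x ∈ S)) : ℤ) := by
  induction l with
  | nil => simp [wtL]
  | cons a l ih =>
    rw [wtL_cons, map_add, ih, degree_wtA, List.countP_cons]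
    simp; ring

theorem degree_omega {S : Set B.Q.A} (hS : B.IsMatching S) (a : B.Q.A) :
    degree hS B.omega = 1 := by
  have h := degree_wtL hS (B.cycleArrows true a)
  rw [hS true a] at h
  have h' : B.wtP (B.faceCycle true a) = B.omega := wt_faceContent true a
  rw [← h', wtP_eq_wtL]
  exact h

theorem pos_of_wtL_eq_zsmul (hB : B.NonDegenerate) {l : List B.Q.A} (hl : l ≠ []) {k : ℤ}
    (h : B.wtL l = k • B.omega) : 0 < k := by
  obtain ⟨a, ha⟩ := List.exists_mem_of_ne_nil l hl
  obtain ⟨S, hS, haS⟩ := hB a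
  have h := congrArg (degree hS) h
  rw [map_zsmul, degree_omega hS a, degree_wtL, smul_eq_mul, mul_one] at h
  rw [← h]
  exact_mod_cast List.countP_pos_iff.2 ⟨a, ha, by simpa using haS⟩

theorem eq_nil_of_wtL_eq_zero (hB : B.NonDegenerate) {l : List B.Q.A} (h : B.wtL l = 0) :
    l = [] := by
  by_contra hl
  exact lt_irrefl _ (pos_of_wtL_eq_zsmul hB hl (k := 0) (by rw [h, zero_smul]))

theorem exists_loop {i : B.Q.V} {a : B.Q.A} (ha : B.Q.src a = i) (k : ℕ) :
    ∃ c : Path B.Q i i, B.wtP c = k • B.omega := by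
  subst ha
  induction k with
  | zero => exact ⟨.nil _, by rw [zero_smul]; exact map_zero B.wt⟩
  | succ k ih =>
    obtain ⟨c, hc⟩ := ih
    refine ⟨c.comp (B.faceCycle true a), ?_⟩
    rw [wtP_comp, hc, succ_nsmul]
    congr 1
    exact wt_faceContent true a

theorem wtP_eq_of_sequiv {i j : B.Q.V} {p q : Path B.Q i j} (h : B.SEquiv p q) :
    B.wtP p = B.wtP q := by
  unfold SEquiv at h
  induction h with
  | base h => obtain ⟨a⟩ := h; rw [wtP_wface, wtP_wface]
  | refl => rfl
  | symm _ ih => exact ih.symm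
  | trans _ _ ih ih' => exact ih.trans ih'
  | comp u v _ ih => simp only [wtP_comp, ih]

/-! ### Positions: weights modulo the weight of the face cycles -/

/-- The group of weights modulo the weight of the face cycles. -/
abbrev Pos (B : BraneTiling) : Type := B.Lam ⧸ Submodule.span ℤ {B.omega}

/-- The change of position along an arrow. -/
def posA (B : BraneTiling) (a : B.Q.A) : B.Pos := (Submodule.span ℤ {B.omega}).mkQ (B.wtA a)

theorem sum_map_posA (l : List B.Q.A) :
    (l.map B.posA).sum = (Submodule.span ℤ {B.omega}).mkQ (B.wtL l) := by
  rw [wtL, map_list_sum, List.map_map]; rfl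

theorem mkQ_eq_zero_iff {x : B.Lam} :
    (Submodule.span ℤ {B.omega}).mkQ x = 0 ↔ ∃ k : ℤ, k • B.omega = x := by
  rw [Submodule.mkQ_apply, Submodule.Quotient.mk_eq_zero, Submodule.mem_span_singleton]
  rfl

theorem sum_map_posA_cycleArrows (s : Bool) (a : B.Q.A) :
    ((B.cycleArrows s a).map B.posA).sum = 0 := by
  rw [sum_map_posA, mkQ_eq_zero_iff]
  refine ⟨1, ?_⟩
  rw [one_smul, ← wt_faceContent s a]
  exact wtP_eq_wtL (B.faceCycle s a)

/-- Finitely supported functions on the arrows with positions which are constant along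
the lifted face cycles of sign `s`: the chains of lifted faces of sign `s`. -/
def faceChains (B : BraneTiling) (s : Bool) : AddSubgroup (B.Q.A × B.Pos → ℤ) where
  carrier := {g | g.support.Finite ∧ ∀ a x, g (B.next s a, x + B.posA a) = g (a, x)}
  zero_mem' := ⟨by simp, fun _ _ => rfl⟩
  add_mem' {f g} hf hg := ⟨(hf.1.union hg.1).subset (Function.support_add f g),
    fun a x => by simp only [Pi.add_apply, hf.2, hg.2]⟩
  neg_mem' {f} hf := ⟨by rw [Function.support_neg]; exact hf.1,
    fun a x => by simp only [Pi.neg_apply, hf.2]⟩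

theorem flagCount_cycleArrows_mem (s : Bool) (a : B.Q.A) (x : B.Pos) :
    flagCount B.posA (B.cycleArrows s a) x ∈ B.faceChains s :=
  ⟨finite_support_flagCount _ _ _, fun b y =>
    flagCount_next_cycleArrows B.posA (sum_map_posA_cycleArrows s a) x b y⟩

theorem exists_faceChains_of_sequiv {i j : B.Q.V} {p q : Path B.Q i j} (h : B.SEquiv p q)
    (x : B.Pos) (a₀ : B.Q.A) (y₀ : B.Pos)
    (hp : ∀ r : Path B.Q i j, B.SEquiv p r → ∀ l₁ l₂, r.arrows = l₁ ++ l₂ →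
      x + (l₁.map B.posA).sum ≠ y₀ + B.posA a₀) :
    ∃ f ∈ B.faceChains true, ∃ g ∈ B.faceChains false,
      flagCount B.posA p.arrows x - flagCount B.posA q.arrows x = f - g ∧ f (a₀, y₀) = 0 := by
  unfold SEquiv at h
  induction h generalizing x with
  | base h =>
    obtain ⟨a⟩ := h
    refine ⟨_, flagCount_cycleArrows_mem true a (x - B.posA a), _,
      flagCount_cycleArrows_mem false a (x - B.posA a), ?_, ?_⟩
    · rw [cycleArrows_eq, cycleArrows_eq, flagCount_cons _ _ (B.wface true a).arrows,
        flagCount_cons _ _ (B.wface false a).arrows, sub_add_cancel, add_sub_add_left_eq_sub]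
    · apply flagCount_eq_zero
      rw [cycleArrows_eq, flags, List.mem_cons, sub_add_cancel]
      rintro (h | h)
      · obtain ⟨rfl, rfl⟩ := Prod.mk.inj h
        exact hp _ (Quiv.PEquiv.refl _) [] _ rfl (by simp)
      · obtain ⟨l₁, l₂, h₁, h₂⟩ := exists_of_mem_flags _ h
        exact hp _ (Quiv.PEquiv.refl _) (l₁ ++ [a₀]) l₂ (by simpa using h₁)
          (by dsimp only at h₂; simp [h₂, add_assoc])
  | refl p => exact ⟨0, zero_mem _, 0, zero_mem _, by simp, rfl⟩
  | symm h ih =>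
    obtain ⟨f, hf, g, hg, h₁, h₂⟩ := ih x fun r hr => hp r (h.symm.trans hr)
    exact ⟨-f, neg_mem hf, -g, neg_mem hg, by rw [← neg_sub, h₁]; abel, by simp [h₂]⟩
  | trans h h' ih ih' =>
    obtain ⟨f, hf, g, hg, h₁, h₂⟩ := ih x hp
    obtain ⟨f', hf', g', hg', h₁', h₂'⟩ := ih' x fun r hr => hp r (h.trans hr)
    refine ⟨f + f', add_mem hf hf', g + g', add_mem hg hg', ?_, by simp [h₂, h₂']⟩
    rw [← sub_add_sub_cancel, h₁, h₁']; abel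
  | @comp i j k l u p q v h ih =>
    obtain ⟨f, hf, g, hg, h₁, h₂⟩ := ih (x + (u.arrows.map B.posA).sum) fun r hr l₁ l₂ hl => by
      have := hp _ (PEquiv.comp u v hr) (u.arrows ++ l₁) (l₂ ++ v.arrows)
        (by simp [Path.arrows_comp, hl])
      simpa [add_assoc] using this
    refine ⟨f, hf, g, hg, ?_, h₂⟩
    have hsum : (p.arrows.map B.posA).sum = (q.arrows.map B.posA).sum := by
      simp only [sum_map_posA, ← wtP_eq_wtL, wtP_eq_of_sequiv h]
    simp only [Path.arrows_comp, flagCount_append, hsum, ← h₁]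
    abel

end BraneTiling

namespace BraneTiling

variable {B : BraneTiling}

/-! ### Torsion-freeness of the group of positions -/

theorem wt_mem_span_omega_iff {x : B.Q.A → ℤ} :
    B.wt x ∈ Submodule.span ℤ {B.omega} ↔
      x ∈ Submodule.span ℤ {y | ∃ s a, y = B.faceContent s a} := by
  constructor
  · intro h
    obtain ⟨k, hk⟩ := Submodule.mem_span_singleton.1 h
    have hle : B.lamRel ≤ Submodule.span ℤ {y | ∃ s a, y = B.faceContent s a} := by
      rw [lamRel, Submodule.span_le]
      rintro _ ⟨s, a, t, b, rfl⟩
      exact sub_mem (Submodule.subset_span ⟨s, a, rfl⟩) (Submodule.subset_span ⟨t, b, rfl⟩)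
    by_cases hA : Nonempty B.Q.A
    · obtain ⟨a⟩ := hA
      rw [← wt_faceContent true a, ← map_smul] at hk
      have := hle ((Submodule.Quotient.eq _).1 hk)
      have h₂ := Submodule.smul_mem _ k
        (Submodule.subset_span (R := ℤ) (s := {y | ∃ s a, y = B.faceContent s a}) ⟨true, a, rfl⟩)
      simpa using sub_mem h₂ this
    · rw [not_nonempty_iff] at hA
      rw [Subsingleton.elim x 0]
      exact zero_mem _
  · intro h
    refine Submodule.span_induction (p := fun x _ => B.wt x ∈ _) ?_ ?_ ?_ ?_ h
    · rintro _ ⟨s, a, rfl⟩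
      rw [wt_faceContent]
      exact Submodule.mem_span_singleton_self _
    · rw [map_zero]; exact zero_mem _
    · intro x y _ _ hx hy
      rw [map_add]; exact add_mem hx hy
    · intro k x _ hx
      rw [map_smul]; exact Submodule.smul_mem _ k hx

theorem exists_next_invariant_of_mem_span {x : B.Q.A → ℤ}
    (h : x ∈ Submodule.span ℤ {y | ∃ s a, y = B.faceContent s a}) :
    ∃ f g : B.Q.A → ℤ, (∀ a, f (B.next true a) = f a) ∧ (∀ a, g (B.next false a) = g a) ∧
      x = f + g := by
  induction h using Submodule.span_induction with
  | mem x h =>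
    obtain ⟨s, a, rfl⟩ := h
    have hinv (b) : B.faceContent s a (B.next s b) = B.faceContent s a b := by
      simp only [faceContent_eq_count, count_next_cycleArrows]
    cases s with
    | true => exact ⟨B.faceContent true a, 0, hinv, fun _ => rfl, by simp⟩
    | false => exact ⟨0, B.faceContent false a, fun _ => rfl, hinv, by simp⟩
  | zero => exact ⟨0, 0, fun _ => rfl, fun _ => rfl, by simp⟩
  | add x y _ _ hx hy =>
    obtain ⟨f, g, hf, hg, rfl⟩ := hx
    obtain ⟨f', g', hf', hg', rfl⟩ := hy
    exact ⟨f + f', g + g', fun a => by simp [hf, hf'], fun a => by simp [hg, hg'], by abel⟩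
  | smul k x _ hx =>
    obtain ⟨f, g, hf, hg, rfl⟩ := hx
    exact ⟨k • f, k • g, fun a => by simp [hf], fun a => by simp [hg], smul_add _ _ _⟩

theorem eq_of_mem_cycleArrows {s : Bool} {f : B.Q.A → ℤ} (hf : ∀ a, f (B.next s a) = f a)
    {a b : B.Q.A} (hb : b ∈ B.cycleArrows s a) : f b = f a := by
  obtain ⟨p, q, h⟩ := List.append_of_mem hb
  clear hb
  induction p using List.reverseRecOn generalizing b q with
  | nil => rw [(List.cons.inj h).1]
  | append_singleton p c ih =>
    have h' : B.cycleArrows s a = p ++ c :: (b :: q) := by simpa using h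
    have hc := cycleArrows_eq_append h'
    rw [cycleArrows_eq, List.cons_append, List.cons.injEq] at hc
    have : B.next s c = b := by rw [next, hc.2]; rfl
    rw [← this, hf, ih _ h']

theorem faceContent_self (hB : B.NonDegenerate) (s : Bool) (a : B.Q.A) :
    B.faceContent s a a = 1 := by
  obtain ⟨S, hS, ha⟩ := hB a
  rw [faceContent_eq_count, Nat.cast_eq_one]
  refine le_antisymm ?_ (List.count_pos_iff.2 List.mem_cons_self)
  rw [← hS s a, List.count_eq_countP]
  refine List.countP_mono_left fun b _ hb => ?_
  simpa [(beq_iff_eq.1 hb)] using ha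

theorem mem_span_of_next_invariant (hB : B.NonDegenerate) {s : Bool} (f : B.Q.A → ℤ)
    (hf : ∀ a, f (B.next s a) = f a) :
    f ∈ Submodule.span ℤ {y | ∃ s a, y = B.faceContent s a} := by
  induction hn : (Finset.univ.filter fun a => f a ≠ 0).card using Nat.strong_induction_on
    generalizing f with
  | _ n ih =>
    by_cases h0 : f = 0
    · rw [h0]; exact zero_mem _
    · obtain ⟨a, ha⟩ := Function.ne_iff.1 h0
      have ha : f a ≠ 0 := ha
      have hmem : f a • B.faceContent s a ∈
          Submodule.span ℤ {y | ∃ s a, y = B.faceContent s a} :=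
        Submodule.smul_mem _ _ (Submodule.subset_span ⟨s, a, rfl⟩)
      rw [← sub_add_cancel f (f a • B.faceContent s a)]
      refine add_mem (ih _ ?_ _ ?_ rfl) hmem
      · rw [← hn]
        refine Finset.card_lt_card (Finset.ssubset_iff_of_subset ?_ |>.2 ⟨a, ?_, ?_⟩)
        · intro b
          simp only [Finset.mem_filter, Finset.mem_univ, true_and]
          intro hb hb0
          have hba : b ∉ B.cycleArrows s a := fun h =>
            ha ((eq_of_mem_cycleArrows hf h).symm.trans hb0)
          apply hb
          simp [hb0, faceContent_eq_count, List.count_eq_zero.2 hba]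
        · simpa using ha
        · simp [faceContent_self hB]
      · intro b
        simp only [Pi.sub_apply, Pi.smul_apply, faceContent_eq_count, count_next_cycleArrows, hf]

theorem mem_span_of_nsmul_mem (hB : B.NonDegenerate) {n : ℕ} (hn : n ≠ 0) {x : B.Q.A → ℤ}
    (h : (n : ℤ) • x ∈ Submodule.span ℤ {y | ∃ s a, y = B.faceContent s a}) :
    x ∈ Submodule.span ℤ {y | ∃ s a, y = B.faceContent s a} := by
  obtain ⟨f, g, hf, hg, hfg⟩ := exists_next_invariant_of_mem_span h
  have hn : (n : ℤ) ≠ 0 := by exact_mod_cast hn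
  have hx : x = (fun a => f a / n) - (fun a => (-g a) / n) := by
    funext a
    have h₁ : (n : ℤ) * x a = f a + g a := by simpa using congrFun hfg a
    have h₂ : f a = -g a + n * x a := by linarith
    simp only [Pi.sub_apply]
    rw [h₂, Int.add_mul_ediv_left _ _ hn]
    ring
  rw [hx]
  exact sub_mem (mem_span_of_next_invariant hB (s := true) _ fun a => by simp only [hf])
    (mem_span_of_next_invariant hB (s := false) _ fun a => by simp only [hg])

theorem mkQ_eq_zero_of_nsmul_eq_zero (hB : B.NonDegenerate) {n : ℕ} (hn : n ≠ 0) {x : B.Lam}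
    (h : n • (Submodule.span ℤ {B.omega}).mkQ x = 0) :
    (Submodule.span ℤ {B.omega}).mkQ x = 0 := by
  obtain ⟨x, rfl⟩ : ∃ y, B.wt y = x := B.lamRel.mkQ_surjective x
  rw [← map_nsmul, Submodule.mkQ_apply, Submodule.Quotient.mk_eq_zero] at h
  rw [Submodule.mkQ_apply, Submodule.Quotient.mk_eq_zero]
  refine wt_mem_span_omega_iff.2 (mem_span_of_nsmul_mem hB hn (wt_mem_span_omega_iff.1 ?_))
  rw [natCast_zsmul, map_nsmul]
  exact h

/-! ### Functions invariant under both kinds of lifted faces -/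

theorem arrows_wface_eq_nil (hB : B.NonDegenerate) {s t : Bool} {a : B.Q.A}
    (h : (B.wface s a).arrows = []) : (B.wface t a).arrows = [] := by
  refine eq_nil_of_wtL_eq_zero hB ?_
  rw [← wtP_eq_wtL, wtP_wface, ← wtP_wface s, wtP_eq_wtL, h, wtL_nil]

theorem head_invariant_of_sequiv (hB : B.NonDegenerate) {G : B.Q.A × B.Pos → ℤ}
    (h₁ : G ∈ B.faceChains true) (h₂ : G ∈ B.faceChains false) {i j : B.Q.V}
    {p q : Path B.Q i j} (h : B.SEquiv p q) :
    (p.arrows = [] ∧ q.arrows = []) ∨ ∃ b c l l', p.arrows = b :: l ∧ q.arrows = c :: l' ∧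
      ∀ x, G (b, x) = G (c, x) := by
  unfold SEquiv at h
  induction h with
  | base h =>
    obtain ⟨a⟩ := h
    rcases ht : (B.wface true a).arrows with _ | ⟨b, l⟩
    · exact .inl ⟨rfl, arrows_wface_eq_nil hB ht⟩
    rcases hf : (B.wface false a).arrows with _ | ⟨c, l'⟩
    · rw [arrows_wface_eq_nil hB hf] at ht
      exact absurd ht (by simp)
    refine .inr ⟨b, c, l, l', rfl, rfl, fun x => ?_⟩
    have hb : B.next true a = b := by rw [next, ht]; rfl
    have hc : B.next false a = c := by rw [next, hf]; rfl
    have e₁ := h₁.2 a (x - B.posA a)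
    have e₂ := h₂.2 a (x - B.posA a)
    rw [sub_add_cancel] at e₁ e₂
    rw [← hb, ← hc, e₁, e₂]
  | refl p =>
    rcases hp : p.arrows with _ | ⟨b, l⟩
    · exact .inl ⟨rfl, rfl⟩
    · exact .inr ⟨b, b, l, l, rfl, rfl, fun _ => rfl⟩
  | symm _ ih =>
    rcases ih with ⟨h, h'⟩ | ⟨b, c, l, l', h, h', e⟩
    · exact .inl ⟨h', h⟩
    · exact .inr ⟨c, b, l', l, h', h, fun x => (e x).symm⟩
  | trans _ _ ih ih' =>
    rcases ih with ⟨h, h'⟩ | ⟨b, c, l, l', h, h', e⟩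
    · rcases ih' with ⟨_, k'⟩ | ⟨_, _, _, _, k, _, _⟩
      · exact .inl ⟨h, k'⟩
      · rw [h'] at k; exact absurd k (by simp)
    · rcases ih' with ⟨k, _⟩ | ⟨d, f, m, m', k, k', e'⟩
      · rw [h'] at k; exact absurd k (by simp)
      · rw [h', List.cons.injEq] at k
        obtain ⟨rfl, rfl⟩ := k
        exact .inr ⟨b, f, l, m', h, k', fun x => (e x).trans (e' x)⟩
  | @comp i j k l u p q v h ih =>
    simp only [Path.arrows_comp]
    rcases hu : u.arrows with _ | ⟨b, l⟩
    · rcases ih with ⟨h, h'⟩ | ⟨b, c, l, l', h, h', e⟩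
      · simp only [h, h', List.nil_append]
        rcases hp : v.arrows with _ | ⟨b, l⟩
        · exact .inl ⟨rfl, rfl⟩
        · exact .inr ⟨b, b, l, l, rfl, rfl, fun _ => rfl⟩
      · exact .inr ⟨b, c, l ++ v.arrows, l' ++ v.arrows, by simp [h], by simp [h'], e⟩
    · exact .inr ⟨b, b, _, _, rfl, rfl, fun _ => rfl⟩

theorem eq_of_src_eq (hB : B.NonDegenerate) (hc : B.Consistent1) {G : B.Q.A × B.Pos → ℤ}
    (h₁ : G ∈ B.faceChains true) (h₂ : G ∈ B.faceChains false) {b c : B.Q.A}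
    (h : B.Q.src b = B.Q.src c) (x : B.Pos) : G (b, x) = G (c, x) := by
  have hw : B.wtP ((B.faceCycle true b).cast h h) = B.wtP (B.faceCycle true c) := by
    rw [wtP_cast]
    exact (wt_faceContent true b).trans (wt_faceContent true c).symm
  obtain ⟨_, hs⟩ := (hc _ _ _ _ _).2 hw
  have := head_invariant_of_sequiv hB h₁ h₂ hs
  simp only [Path.arrows_cast, faceCycle, Path.arrows] at this
  rcases this with ⟨h, _⟩ | ⟨_, _, _, _, h, h', e⟩
  · exact absurd h (by simp)
  · rw [(List.cons.inj h).1, (List.cons.inj h').1, e]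

theorem eq_of_path (hB : B.NonDegenerate) (hc : B.Consistent1) {G : B.Q.A × B.Pos → ℤ}
    (h₁ : G ∈ B.faceChains true) (h₂ : G ∈ B.faceChains false) {i j : B.Q.V} (p : Path B.Q i j)
    {b c : B.Q.A} (hb : B.Q.src b = i) (hc' : B.Q.src c = j) (x : B.Pos) :
    G (c, x + (p.arrows.map B.posA).sum) = G (b, x) := by
  induction p generalizing b x with
  | nil i =>
    simp only [Path.arrows, List.map_nil, List.sum_nil, add_zero]
    exact eq_of_src_eq hB hc h₁ h₂ (hc'.trans hb.symm) x
  | cons a p ih =>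
    rw [Path.arrows, List.map_cons, List.sum_cons, ← add_assoc,
      ih (src_next true a) hc', h₁.2, eq_of_src_eq hB hc h₁ h₂ hb.symm]

theorem exists_zsmul_omega_of_loop (hB : B.NonDegenerate) (hc : B.Consistent1)
    {G : B.Q.A × B.Pos → ℤ} (h₁ : G ∈ B.faceChains true) (h₂ : G ∈ B.faceChains false)
    {b : B.Q.A} {x : B.Pos} (hG : G (b, x) ≠ 0) {i : B.Q.V} (hb : B.Q.src b = i)
    (p : Path B.Q i i) : ∃ k : ℤ, k • B.omega = B.wtP p := by
  set d := (p.arrows.map B.posA).sum with hd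
  have key (n : ℕ) : G (b, x + n • d) ≠ 0 := by
    induction n with
    | zero => simpa using hG
    | succ n ih => rwa [succ_nsmul, ← add_assoc, eq_of_path hB hc h₁ h₂ p hb hb]
  rw [← mkQ_eq_zero_iff, wtP_eq_wtL, ← sum_map_posA, ← hd]
  obtain ⟨n, n', hne, hnn'⟩ := Set.Finite.exists_lt_map_eq_of_forall_mem
    (f := fun n : ℕ => (b, x + n • d)) (t := G.support) (fun n => key n) h₁.1
  have hnd : n • d = n' • d := by simpa using hnn'
  have : (n' - n) • d = 0 := by
    rw [← add_right_inj (n • d), ← add_nsmul, Nat.add_sub_cancel' hne.le, hnd, add_zero]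
  rw [hd, sum_map_posA] at this ⊢
  exact mkQ_eq_zero_of_nsmul_eq_zero hB (Nat.sub_ne_zero_of_lt hne) this

end BraneTiling

namespace BraneTiling

variable {B : BraneTiling}

/-! ### Vertices violating the extension property -/

theorem sum_map_posA_ne_zero (hB : B.NonDegenerate) (hc : B.Consistent1) {i j : B.Q.V}
    {U : B.Lam} (hU : ∀ (j : B.Q.V) (r : Path B.Q i j), B.wtP r ≠ U - B.omega)
    (p : Path B.Q i j) (hp : B.wtP p = U) {l₁ l₂ : List B.Q.A} (h : p.arrows = l₁ ++ l₂)
    (hne : l₁ ≠ []) : (l₁.map B.posA).sum ≠ 0 := by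
  intro h0
  rw [sum_map_posA, mkQ_eq_zero_iff] at h0
  obtain ⟨k, hk⟩ := h0
  have hpos := pos_of_wtL_eq_zsmul hB hne hk.symm
  obtain ⟨v, u, w, rfl, rfl, rfl⟩ := p.exists_eq_comp h
  obtain ⟨b, l, hb⟩ := List.exists_cons_of_ne_nil hne
  have hbi := (u.exists_eq_cons hb).1
  obtain ⟨m, rfl⟩ : ∃ m : ℕ, k = m + 1 := ⟨(k - 1).toNat, by omega⟩
  obtain ⟨c, hcw⟩ := exists_loop hbi (m + 1)
  obtain ⟨c', hcw'⟩ := exists_loop hbi m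
  have : B.wtP u = B.wtP c := by
    rw [wtP_eq_wtL, ← hk, hcw, ← natCast_zsmul]; push_cast; rfl
  obtain ⟨rfl, _⟩ := (hc _ _ _ u c).2 this
  refine hU _ (c'.comp w) ?_
  rw [wtP_comp, this, hcw, succ_nsmul] at hp
  rw [wtP_comp, hcw', ← hp]
  abel

theorem exists_faceChain_of_next_ne_nil (hB : B.NonDegenerate) (hc : B.Consistent1) {i : B.Q.V}
    {U : B.Lam} (hU : ∀ (j : B.Q.V) (r : Path B.Q i j), B.wtP r ≠ U - B.omega)
    (hext : ∀ a, B.Q.tgt a = i → ∃ (j : B.Q.V) (v : Path B.Q (B.Q.src a) j),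
      B.wtP v = U - B.omega + B.wtA a)
    (hnil : ∀ s a, B.Q.tgt a = i → (B.wface s a).arrows ≠ []) {a₀ : B.Q.A}
    (ha₀ : B.Q.tgt a₀ = i) :
    ∃ G ∈ B.faceChains true, G ∈ B.faceChains false ∧ G (a₀, -B.posA a₀) ≠ 0 := by
  choose j v hv using hext
  let I := {a : B.Q.A // B.Q.tgt a = i}
  let τ : Equiv.Perm B.Q.A := (B.nextEquiv false).trans (B.nextEquiv true).symm
  have hτ (a) : B.next true (τ a) = B.next false a := (B.nextEquiv true).apply_symm_apply _
  have hτi (a) : B.Q.tgt (τ a) = i ↔ B.Q.tgt a = i := by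
    rw [← src_next true, hτ, src_next]
  let τI : Equiv.Perm I := τ.subtypePerm hτi
  let r (s : Bool) (a : I) : Path B.Q (B.Q.tgt a.1) (j a.1 a.2) :=
    (B.wface s a.1).comp (v a.1 a.2)
  have hr (s) (a : I) : B.wtP (r s a) = U := by
    simp only [r]; rw [wtP_comp, wtP_wface, hv]; abel
  have hhead (s) (a : I) : ∃ l, (r s a).arrows = B.next s a.1 :: l := by
    obtain ⟨b, l, hb⟩ := List.exists_cons_of_ne_nil (hnil s a.1 a.2)
    simp only [r]
    rw [Path.arrows_comp, next, hb]
    exact ⟨_, rfl⟩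
  have key (a : I) : ∃ f ∈ B.faceChains true, ∃ g ∈ B.faceChains false,
      flagCount B.posA (r false a).arrows 0 - flagCount B.posA (r true (τI a)).arrows 0 = f - g ∧
      f (a₀, -B.posA a₀) = 0 := by
    obtain ⟨l, hl⟩ := hhead false a
    obtain ⟨l', hl'⟩ := hhead true (τI a)
    rw [show B.next true (τI a).1 = B.next false a.1 from hτ a.1] at hl'
    set b := B.next false a.1 with hb
    have hwb (s) (a : I) {l} (hl : (r s a).arrows = b :: l) : B.wtA b + B.wtL l = U := by
      rw [← hr s a, wtP_eq_wtL, hl, wtL_cons]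
    have hbi : B.Q.src b = i := (src_next false a.1).trans a.2
    obtain ⟨_, p, rfl, -⟩ := (r false a).exists_eq_cons hl
    obtain ⟨_, p', rfl, -⟩ := (r true (τI a)).exists_eq_cons hl'
    have hpp' : B.wtP p = B.wtP p' := by
      rw [wtP_eq_wtL, wtP_eq_wtL, ← add_right_inj (B.wtA b), hwb _ _ hl, hwb _ _ hl']
    obtain ⟨e, hs⟩ := (hc _ _ _ p p').2 hpp'
    rw [hl, hl']
    have avoid : ∀ q, B.SEquiv (p.cast rfl e) q → ∀ l₁ l₂, q.arrows = l₁ ++ l₂ →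
        B.posA b + (l₁.map B.posA).sum ≠ -B.posA a₀ + B.posA a₀ := by
      intro q hq l₁ l₂ hl₁
      rw [neg_add_cancel, ← List.sum_cons, ← List.map_cons]
      refine sum_map_posA_ne_zero (U := U) hB hc (fun j r => ?_) (.cons b q) ?_
        (l₁ := b :: l₁) (l₂ := l₂)
        (by simp [Path.arrows, hl₁]) (by simp)
      · have := hU j (r.cast hbi rfl)
        rwa [wtP_cast] at this
      · rw [wtP_cons, ← wtP_eq_of_sequiv hq, wtP_cast, wtP_eq_wtL, hwb _ _ hl]
    obtain ⟨f, hf, g, hg, h₁, h₂⟩ :=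
      exists_faceChains_of_sequiv hs (B.posA b) a₀ (-B.posA a₀) avoid
    refine ⟨f, hf, g, hg, ?_, h₂⟩
    rw [flagCount_cons _ _ p.arrows, flagCount_cons _ _ p'.arrows, zero_add,
      add_sub_add_left_eq_sub, ← h₁, Path.arrows_cast]
  choose f hf g hg hfg hf0 using key
  let D (s : Bool) (a : I) : B.Q.A × B.Pos → ℤ :=
    flagCount B.posA (B.cycleArrows s a.1) (-B.posA a.1)
  have hD (a : I) : flagCount B.posA (r true a).arrows 0 - flagCount B.posA (r false a).arrows 0 =
      D true a - D false a := by
    simp only [r, D, Path.arrows_comp, flagCount_append, cycleArrows_eq]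
    rw [flagCount_cons _ _ (B.wface true a.1).arrows, flagCount_cons _ _ (B.wface false a.1).arrows]
    simp only [sum_map_posA, ← wtP_eq_wtL, wtP_wface, neg_add_cancel]
    abel
  have hsum : ∑ a : I, (D true a + f a) = ∑ a : I, (D false a + g a) := by
    have h₁ : ∑ a : I, ((D true a + f a) - (D false a + g a)) =
        ∑ a : I, (flagCount B.posA (r true a).arrows 0 -
          flagCount B.posA (r true (τI a)).arrows 0) := by
      refine Finset.sum_congr rfl fun a _ => ?_
      rw [add_sub_add_comm, ← hfg, ← hD]
      abel
    rw [Finset.sum_sub_distrib, Finset.sum_sub_distrib,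
      Equiv.sum_comp τI fun a => flagCount B.posA (r true a).arrows 0, sub_self] at h₁
    exact sub_eq_zero.1 h₁
  refine ⟨∑ a : I, (D true a + f a), sum_mem fun a _ =>
    add_mem (flagCount_cycleArrows_mem _ _ _) (hf a), ?_, ?_⟩
  · rw [hsum]
    exact sum_mem fun a _ => add_mem (flagCount_cycleArrows_mem _ _ _) (hg a)
  · rw [Finset.sum_apply]
    refine (Finset.sum_pos' (fun a _ => ?_) ⟨⟨a₀, ha₀⟩, Finset.mem_univ _, ?_⟩).ne'
    · rw [Pi.add_apply, hf0, add_zero]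
      exact Int.natCast_nonneg _
    · rw [Pi.add_apply, hf0, add_zero]
      exact Int.natCast_pos.2 (List.count_pos_iff.2 List.mem_cons_self)

theorem exists_zsmul_omega_of_not_extendable (hB : B.NonDegenerate) (hc : B.Consistent1)
    {i : B.Q.V} {U : B.Lam} (hU : ∀ (j : B.Q.V) (r : Path B.Q i j), B.wtP r ≠ U - B.omega)
    (hext : ∀ a, B.Q.tgt a = i → ∃ (j : B.Q.V) (v : Path B.Q (B.Q.src a) j),
      B.wtP v = U - B.omega + B.wtA a)
    {a₀ : B.Q.A} (ha₀ : B.Q.tgt a₀ = i) (p : Path B.Q i i) :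
    ∃ k : ℤ, k • B.omega = B.wtP p := by
  by_cases hnil : ∀ s a, B.Q.tgt a = i → (B.wface s a).arrows ≠ []
  · obtain ⟨G, h₁, h₂, hG⟩ := exists_faceChain_of_next_ne_nil hB hc hU hext hnil ha₀
    refine exists_zsmul_omega_of_loop hB hc h₁ h₂ (b := B.next true a₀)
      (x := -B.posA a₀ + B.posA a₀) ?_ ((src_next _ _).trans ha₀) p
    rwa [h₁.2]
  · push Not at hnil
    obtain ⟨s, a, ha, hs⟩ := hnil
    have hcyc (t) : B.cycleArrows t a = [a] := by
      rw [cycleArrows_eq, arrows_wface_eq_nil hB hs]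
    have hmem (t) : flagCount B.posA [a] 0 ∈ B.faceChains t := by
      rw [← hcyc t]; exact flagCount_cycleArrows_mem t a 0
    refine exists_zsmul_omega_of_loop hB hc (hmem true) (hmem false) (b := a) (x := 0) ?_
      ((Path.eq_endpoints_of_arrows_eq_nil _ hs).symm.trans ha) p
    simp [flagCount, flags]

end BraneTiling

namespace Quiv

namespace Path

variable {Q : Quiv}

theorem eq_of_map_arrows_eq {X : Type} {f : Q.A → X}
    (hf : ∀ a b, Q.src a = Q.src b → f a = f b → a = b) {i j j' : Q.V} (p : Path Q i j)
    (q : Path Q i j') (h : p.arrows.map f = q.arrows.map f) :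
    ∃ e : j = j', p.cast rfl e = q := by
  induction p with
  | nil i =>
    cases q with
    | nil => exact ⟨rfl, rfl⟩
    | cons b q => simp [arrows] at h
  | cons a p ih =>
    rcases hq : q.arrows with _ | ⟨b, l⟩
    · simp [arrows, hq] at h
    · obtain ⟨e, q', rfl, rfl⟩ := q.exists_eq_cons hq
      rw [hq, arrows, List.map_cons, List.map_cons] at h
      obtain ⟨h₁, h₂⟩ := List.cons.inj h
      obtain rfl := hf a b e.symm h₁
      obtain ⟨rfl, rfl⟩ := ih q' h₂
      exact ⟨rfl, rfl⟩

theorem exists_tgt_eq {i j : Q.V} (p : Path Q i j) (h : ∃ a, Q.tgt a = i) : ∃ a, Q.tgt a = j := by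
  induction p with
  | nil => exact h
  | cons a p ih => exact ih ⟨a, rfl⟩

theorem exists_src_eq {i j : Q.V} (p : Path Q i j) (h : ∃ a, Q.src a = j) : ∃ a, Q.src a = i := by
  cases p with
  | nil => exact h
  | cons a p => exact ⟨a, rfl⟩

end Path

end Quiv

namespace Periodic

variable {B : BraneTiling} {P : Periodic B}

/-! ### Weights of paths in the periodic quiver -/

theorem wtP_eq_wtL {i j : P.tQ.V} (p : Path P.tQ i j) :
    P.wtP p = B.wtL (p.arrows.map P.proj.onA) := by
  rw [← Path.arrows_map, ← BraneTiling.wtP_eq_wtL]; rfl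

theorem wtP_nil (i : P.tQ.V) : P.wtP (.nil i) = 0 := wtP_eq_wtL _

theorem wtP_cons {j : P.tQ.V} (a : P.tQ.A) (p : Path P.tQ (P.tQ.tgt a) j) :
    P.wtP (.cons a p) = B.wtA (P.proj.onA a) + P.wtP p := by
  simp only [wtP_eq_wtL, Path.arrows, List.map_cons, BraneTiling.wtL_cons]

theorem wtP_comp {i j k : P.tQ.V} (p : Path P.tQ i j) (q : Path P.tQ j k) :
    P.wtP (p.comp q) = P.wtP p + P.wtP q := by
  simp only [wtP_eq_wtL, Path.arrows_comp, List.map_append, BraneTiling.wtL_append]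

theorem wtP_single (a : P.tQ.A) : P.wtP (.single a) = B.wtA (P.proj.onA a) := by
  rw [Path.single, wtP_cons, wtP_nil, add_zero]

theorem map_arrows_twface (s : Bool) (a : P.tQ.A) :
    (P.twface s a).arrows.map P.proj.onA = (B.wface s (P.proj.onA a)).arrows := by
  rw [← Path.arrows_map, P.proj_twface, Path.arrows_cast]

theorem wtP_twface (s : Bool) (a : P.tQ.A) :
    P.wtP (P.twface s a) = B.omega - B.wtA (P.proj.onA a) := by
  rw [wtP_eq_wtL, map_arrows_twface, ← BraneTiling.wtP_eq_wtL, BraneTiling.wtP_wface]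

theorem wtP_faceCycle (s : Bool) (a : P.tQ.A) : P.wtP (P.faceCycle s a) = B.omega := by
  rw [faceCycle, wtP_cons, wtP_twface, add_sub_cancel]

theorem wtW_nil (i : P.tQ.V) : P.wtW (.nil i) = 0 := map_zero B.wt

theorem wtW_fwd {j : P.tQ.V} (a : P.tQ.A) (p : WPath P.tQ (P.tQ.tgt a) j) :
    P.wtW (.fwd a p) = B.wtA (P.proj.onA a) + P.wtW p := by
  simp only [wtW, WPath.map, WPath.content_cast, WPath.content, map_add, BraneTiling.wtA,
    Path.single, Path.content, add_zero]

theorem wtW_bwd {j : P.tQ.V} (a : P.tQ.A) (p : WPath P.tQ (P.tQ.src a) j) :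
    P.wtW (.bwd a p) = -B.wtA (P.proj.onA a) + P.wtW p := by
  simp only [wtW, WPath.map, WPath.content_cast, WPath.content, map_add, BraneTiling.wtA,
    Path.single, Path.content, add_zero, ← map_neg]
  congr 2
  funext b
  simp only [Pi.neg_apply]
  split <;> rfl

theorem wtW_comp {i j k : P.tQ.V} (p : WPath P.tQ i j) (q : WPath P.tQ j k) :
    P.wtW (p.comp q) = P.wtW p + P.wtW q := by
  induction p with
  | nil => rw [wtW_nil, zero_add]; rfl
  | fwd a p ih => rw [WPath.comp, wtW_fwd, wtW_fwd, ih, add_assoc]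
  | bwd a p ih => rw [WPath.comp, wtW_bwd, wtW_bwd, ih, add_assoc]

theorem wtW_reverse {i j : P.tQ.V} (p : WPath P.tQ i j) : P.wtW p.reverse = -P.wtW p := by
  induction p with
  | nil => rw [WPath.reverse, wtW_nil, neg_zero]
  | fwd a p ih => rw [WPath.reverse, wtW_comp, wtW_fwd, wtW_bwd, wtW_nil, ih]; abel
  | bwd a p ih => rw [WPath.reverse, wtW_comp, wtW_fwd, wtW_bwd, wtW_nil, ih]; abel

theorem wtW_cast {i i' j j' : P.tQ.V} (hi : i = i') (hj : j = j') (p : WPath P.tQ i j) :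
    P.wtW (p.cast hi hj) = P.wtW p := by
  subst hi hj; rfl

theorem wtW_npow {i : P.tQ.V} (c : WPath P.tQ i i) (k : ℕ) : P.wtW (c.npow k) = k • P.wtW c := by
  induction k with
  | zero => rw [WPath.npow, wtW_nil, zero_smul]
  | succ k ih => rw [WPath.npow, wtW_comp, ih, succ_nsmul']

theorem wtW_toWeak {i j : P.tQ.V} (p : Path P.tQ i j) : P.wtW p.toWeak = P.wtP p := by
  induction p with
  | nil => rw [Path.toWeak, wtW_nil, wtP_nil]
  | cons a p ih => rw [Path.toWeak, wtW_fwd, wtP_cons, ih]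

theorem wtW_eq_of_wkEquiv {i j : P.tQ.V} {p q : WPath P.tQ i j} (h : P.WkEquiv p q) :
    P.wtW p = P.wtW q := by
  unfold WkEquiv at h
  induction h with
  | base h =>
    obtain ⟨s, t, a, b, h⟩ := h
    rw [wtW_cast, wtW_toWeak, wtW_toWeak, wtP_faceCycle, wtP_faceCycle]
  | cancel_fwd a => rw [wtW_fwd, wtW_bwd, wtW_nil]; abel
  | cancel_bwd a => rw [wtW_bwd, wtW_fwd, wtW_nil]; abel
  | refl => rfl
  | symm _ ih => exact ih.symm
  | trans _ _ h₁ h₂ => exact h₁.trans h₂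
  | comp u v _ ih => simp only [wtW_comp, ih]

theorem exists_loop {i : P.tQ.V} (hi : ∃ c : Path P.tQ i i, P.wtP c = B.omega) (k : ℕ) :
    ∃ c : Path P.tQ i i, P.wtP c = k • B.omega := by
  obtain ⟨c, hc⟩ := hi
  induction k with
  | zero => exact ⟨.nil _, by rw [zero_smul, wtP_nil]⟩
  | succ k ih =>
    obtain ⟨d, hd⟩ := ih
    exact ⟨d.comp c, by rw [wtP_comp, hd, hc, succ_nsmul]⟩

theorem exists_loop_src (a : P.tQ.A) :
    ∃ c : Path P.tQ (P.tQ.src a) (P.tQ.src a), P.wtP c = B.omega :=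
  ⟨P.faceCycle true a, wtP_faceCycle _ _⟩

theorem exists_loop_tgt (a : P.tQ.A) :
    ∃ c : Path P.tQ (P.tQ.tgt a) (P.tQ.tgt a), P.wtP c = B.omega :=
  ⟨(P.twface true a).comp (.single a), by
    rw [wtP_comp, wtP_twface, wtP_single, sub_add_cancel]⟩

theorem exists_return {i j : P.tQ.V} (p : Path P.tQ i j) : Nonempty (Path P.tQ j i) := by
  induction p with
  | nil i => exact ⟨.nil i⟩
  | cons a p ih => exact ih.map fun r => r.comp (P.twface true a)

/-! ### Lifting paths and strict equivalences -/

theorem eq_of_map_arrows_eq {i j j' : P.tQ.V} (p : Path P.tQ i j) (q : Path P.tQ i j')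
    (h : p.arrows.map P.proj.onA = q.arrows.map P.proj.onA) :
    ∃ e : j = j', p.cast rfl e = q :=
  Path.eq_of_map_arrows_eq (fun _ b hs hab => (P.liftSrc (P.proj.onA b) (P.tQ.src b)
    (P.proj.src_comm b).symm).unique ⟨hab, hs⟩ ⟨rfl, rfl⟩) p q h

theorem exists_lift {x y : B.Q.V} (p : Path B.Q x y) (i : P.tQ.V) (hi : P.proj.onV i = x) :
    ∃ (j : P.tQ.V) (q : Path P.tQ i j), q.arrows.map P.proj.onA = p.arrows := by
  induction p generalizing i with
  | nil => exact ⟨i, .nil i, rfl⟩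
  | cons a p ih =>
    obtain ⟨b, ⟨rfl, rfl⟩, -⟩ := P.liftSrc a i hi
    obtain ⟨j, q, hq⟩ := ih (P.tQ.tgt b) (P.proj.tgt_comm b).symm
    exact ⟨j, .cons b q, by simp [Path.arrows, hq]⟩

theorem exists_eq_comp {i j : P.tQ.V} (p : Path P.tQ i j) {x y : B.Q.V} (hi : P.proj.onV i = x)
    {u : Path B.Q x y} {l : List B.Q.A} (h : p.arrows.map P.proj.onA = u.arrows ++ l) :
    ∃ (k : P.tQ.V) (p₁ : Path P.tQ i k) (p₂ : Path P.tQ k j), P.proj.onV k = y ∧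
      p₁.arrows.map P.proj.onA = u.arrows ∧ p₂.arrows.map P.proj.onA = l ∧ p = p₁.comp p₂ := by
  obtain ⟨l₁, l₂, hl, h₁, h₂⟩ := List.map_eq_append_iff.1 h
  obtain ⟨k, p₁, p₂, rfl, rfl, rfl⟩ := p.exists_eq_comp hl
  subst hi
  obtain ⟨e, -⟩ := Path.eq_of_map_arrows_eq (f := id) (fun _ _ _ h => h) (p₁.map P.proj) u
    (by rw [Path.arrows_map, h₁])
  exact ⟨k, p₁, p₂, e, h₁, h₂, rfl⟩

variable (P) in
/-- The lifts of `p` to the periodic quiver are weakly equivalent to lifts of `q`. -/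
def LiftEquiv {x y : B.Q.V} (p q : Path B.Q x y) : Prop :=
  ∀ (i j : P.tQ.V) (p' : Path P.tQ i j), P.proj.onV i = x →
    p'.arrows.map P.proj.onA = p.arrows →
      ∃ q' : Path P.tQ i j, q'.arrows.map P.proj.onA = q.arrows ∧ P.WkEquiv p'.toWeak q'.toWeak

theorem LiftEquiv.trans {x y : B.Q.V} {p q r : Path B.Q x y} (h₁ : P.LiftEquiv p q)
    (h₂ : P.LiftEquiv q r) : P.LiftEquiv p r := by
  intro i j p' hi hp
  obtain ⟨q', hq, hpq⟩ := h₁ i j p' hi hp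
  obtain ⟨r', hr, hqr⟩ := h₂ i j q' hi hq
  exact ⟨r', hr, WEquiv.trans hpq hqr⟩

theorem liftEquiv_wface (s t : Bool) (a : B.Q.A) :
    P.LiftEquiv (B.wface s a) (B.wface t a) := by
  intro i j p' hi hp
  obtain ⟨b, ⟨rfl, rfl⟩, -⟩ := P.liftTgt a i hi
  obtain ⟨rfl, rfl⟩ := eq_of_map_arrows_eq (P.twface s b) p' (by rw [map_arrows_twface, hp])
  exact ⟨P.twface t b, map_arrows_twface _ _, WEquiv.of_fwd b (.base (faceRel.mk s t b b rfl))⟩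

theorem LiftEquiv.comp {x y z w : B.Q.V} (u : Path B.Q x y) {p q : Path B.Q y z}
    (v : Path B.Q z w) (h : P.LiftEquiv p q) :
    P.LiftEquiv (u.comp (p.comp v)) (u.comp (q.comp v)) := by
  intro i j p' hi hp
  rw [Path.arrows_comp, Path.arrows_comp] at hp
  obtain ⟨k, p₁, p₂, hk, h₁, h₂, rfl⟩ := exists_eq_comp p' hi hp
  obtain ⟨l, p₃, p₄, -, h₃, h₄, rfl⟩ := exists_eq_comp p₂ hk h₂
  obtain ⟨q', hq, hpq⟩ := h k l p₃ hk h₃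
  refine ⟨p₁.comp (q'.comp p₄), by simp [Path.arrows_comp, h₁, hq, h₄], ?_⟩
  simp only [Path.comp_toWeak]
  exact WEquiv.comp _ _ hpq

theorem liftEquiv_of_sequiv {x y : B.Q.V} {p q : Path B.Q x y} (h : B.SEquiv p q) :
    P.LiftEquiv p q ∧ P.LiftEquiv q p := by
  unfold BraneTiling.SEquiv at h
  induction h with
  | base h => obtain ⟨a⟩ := h; exact ⟨liftEquiv_wface _ _ a, liftEquiv_wface _ _ a⟩
  | refl p => exact ⟨fun _ _ p' _ hp => ⟨p', hp, .refl _⟩, fun _ _ p' _ hp => ⟨p', hp, .refl _⟩⟩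
  | symm _ ih => exact ih.symm
  | trans _ _ h₁ h₂ => exact ⟨h₁.1.trans h₂.1, h₂.2.trans h₁.2⟩
  | comp u v _ ih => exact ⟨ih.1.comp u v, ih.2.comp u v⟩

/-! ### Weak equivalence and weights -/

theorem wkEquiv_of_wtP_eq (hc : B.Consistent1) {i j j' : P.tQ.V} (p : Path P.tQ i j)
    (q : Path P.tQ i j') (h : P.wtP p = P.wtP q) :
    ∃ e : j = j', P.WkEquiv (p.cast rfl e).toWeak q.toWeak := by
  obtain ⟨_, hs⟩ := (hc _ _ _ (p.map P.proj) (q.map P.proj)).2 h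
  obtain ⟨q', hq, hpq⟩ := (liftEquiv_of_sequiv hs).1 i j p rfl
    (by rw [Path.arrows_cast, Path.arrows_map])
  obtain ⟨rfl, rfl⟩ := eq_of_map_arrows_eq q' q (by rw [hq, Path.arrows_map])
  exact ⟨rfl, hpq⟩

theorem exists_wkEquiv_strict (hc : B.Consistent1) {i j : P.tQ.V} (w : WPath P.tQ i j)
    (hi : ∃ c : Path P.tQ i i, P.wtP c = B.omega) :
    ∃ (k : ℕ) (c : Path P.tQ i i) (p : Path P.tQ i j),
      P.wtP c = k • B.omega ∧ P.WkEquiv (c.toWeak.comp w) p.toWeak := by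
  induction w with
  | nil i => exact ⟨0, .nil i, .nil i, by rw [wtP_nil, zero_smul], .refl _⟩
  | fwd a w ih =>
    obtain ⟨k, c', p', hc', hp'⟩ := ih (exists_loop_tgt a)
    obtain ⟨c, hcw⟩ := exists_loop hi k
    refine ⟨k, c, .cons a p', hcw, ?_⟩
    obtain ⟨_, h⟩ := wkEquiv_of_wtP_eq hc (c.comp (.single a)) (.cons a c')
      (by rw [wtP_comp, wtP_single, wtP_cons, hcw, hc', add_comm])
    have h₁ := WEquiv.comp_right w h
    have h₂ := WEquiv.comp_left (.fwd a (.nil _)) hp'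
    change P.WkEquiv ((c.comp (.single a)).toWeak.comp w) _ at h₁
    rw [Path.comp_toWeak, WPath.comp_assoc] at h₁
    exact h₁.trans h₂
  | bwd a w ih =>
    obtain ⟨k, c', p', hc', hp'⟩ := ih (exists_loop_src a)
    refine ⟨k + 1, (P.twface true a).comp (c'.comp (.single a)), (P.twface true a).comp p', ?_, ?_⟩
    · rw [wtP_comp, wtP_comp, wtP_single, wtP_twface, hc', succ_nsmul]; abel
    · simp only [Path.comp_toWeak, WPath.comp_assoc]
      refine WEquiv.comp_left _ (WEquiv.trans (WEquiv.comp_left _ ?_) hp')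
      exact (WEquiv.cancel_fwd a).comp_right w

theorem wkEquiv_of_wtW_eq (hc : B.Consistent1) {i j : P.tQ.V}
    (hi : ∃ c : Path P.tQ i i, P.wtP c = B.omega) {w : WPath P.tQ i j} {p : Path P.tQ i j}
    (h : P.wtW w = P.wtP p) : P.WkEquiv w p.toWeak := by
  obtain ⟨k, c, p', -, hp'⟩ := exists_wkEquiv_strict hc w hi
  obtain ⟨_, hcp⟩ := wkEquiv_of_wtP_eq hc p' (c.comp p) (by
    rw [← wtW_toWeak p', ← wtW_eq_of_wkEquiv hp', wtW_comp, wtW_toWeak, h, wtP_comp])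
  rw [Path.comp_toWeak] at hcp
  exact WEquiv.of_comp_left c (WEquiv.trans hp' hcp)

theorem shortest_iff (hc : B.Consistent1) {i j : P.tQ.V} (u : Path P.tQ i j) :
    P.Shortest u ↔ (∃ a, P.tQ.src a = i) ∧
      ∀ p : Path P.tQ i j, ∃ k : ℕ, P.wtP p = k • B.omega + P.wtP u := by
  have key (s : Bool) (a : P.tQ.A) (h : P.tQ.src a = i) (k : ℕ) :
      P.wtW (((((P.faceCycle s a).toWeak).npow k).cast h h).comp u.toWeak) =
        k • B.omega + P.wtP u := by
    rw [wtW_comp, wtW_cast, wtW_npow, wtW_toWeak, wtW_toWeak, wtP_faceCycle]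
  refine ⟨fun hu => ⟨?_, fun p => ?_⟩, ?_⟩
  · obtain ⟨-, a, h, -⟩ := hu u
    exact ⟨a, h⟩
  · obtain ⟨s, a, h, k, hp⟩ := hu p
    exact ⟨k, by rw [← key s a h k, ← wtW_eq_of_wkEquiv hp, wtW_toWeak]⟩
  · rintro ⟨⟨a, rfl⟩, hu⟩ p
    obtain ⟨k, hk⟩ := hu p
    exact ⟨true, a, rfl, k,
      (wkEquiv_of_wtW_eq hc (exists_loop_src a) ((key true a rfl k).trans hk.symm)).symm⟩

theorem exists_shortest_extension (hB : B.NonDegenerate) (hc : B.Consistent1)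
    (hw : ∀ (i j : P.tQ.V) (w : WPath P.tQ i j),
      (∀ (a : P.tQ.A) (h : P.tQ.tgt a = i), ∃ p : Path P.tQ (P.tQ.src a) j,
        P.WkEquiv ((((Path.single a).cast rfl h).toWeak).comp w) p.toWeak) →
      ∃ p : Path P.tQ i j, P.WkEquiv w p.toWeak)
    {i j : P.tQ.V} {u : Path P.tQ i j} (hu : P.Shortest u) :
    ∃ (a : P.tQ.A) (h : P.tQ.tgt a = i),
      P.Shortest (((Path.single a).cast rfl h).comp u) := by
  obtain ⟨⟨b, hb⟩, hu⟩ := (shortest_iff hc u).1 hu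
  obtain ⟨c, hcw⟩ : ∃ c : Path P.tQ i i, P.wtP c = B.omega := by
    subst hb; exact exists_loop_src b
  by_contra! hcon
  have hwt : P.wtW (c.toWeak.reverse.comp u.toWeak) = P.wtP u - B.omega := by
    rw [wtW_comp, wtW_reverse, wtW_toWeak, wtW_toWeak, hcw]; abel
  obtain ⟨p, hp⟩ := hw i j (c.toWeak.reverse.comp u.toWeak) (by
    rintro a rfl
    have ha := hcon a rfl
    rw [shortest_iff hc, not_and] at ha
    have ha := ha ⟨a, rfl⟩
    push Not at ha
    obtain ⟨p, hp⟩ := ha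
    refine ⟨p, wkEquiv_of_wtW_eq hc (exists_loop_src a) ?_⟩
    obtain ⟨k, hk⟩ := hu ((P.twface true a).comp p)
    rw [wtP_comp, wtP_twface] at hk
    obtain _ | k := k
    · rw [wtW_comp, hwt, wtW_toWeak]
      change P.wtP (.single a) + _ = _
      rw [wtP_single, ← sub_eq_zero]
      rw [zero_smul, zero_add] at hk
      rw [← hk]; abel
    · refine absurd ?_ (hp k)
      change _ = _ + P.wtP ((Path.single a).comp u)
      rw [wtP_comp, wtP_single]
      rw [succ_nsmul] at hk
      rw [← sub_eq_zero] at hk ⊢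
      rw [← hk]; abel)
  obtain ⟨k, hk⟩ := hu p
  rw [← wtW_toWeak p, ← wtW_eq_of_wkEquiv hp, hwt] at hk
  obtain ⟨S, hS, -⟩ := hB (P.proj.onA b)
  have := congrArg (BraneTiling.degree hS) hk
  rw [map_sub, map_add, map_nsmul, BraneTiling.degree_omega hS (P.proj.onA b), nsmul_eq_mul] at this
  omega

theorem exists_shortest_of_loops (hB : B.NonDegenerate) (hc : B.Consistent1) {i j : P.tQ.V}
    (hi : ∃ a, P.tQ.src a = i) (p₀ : Path P.tQ i j)
    (hloop : ∀ c : Path P.tQ i i, ∃ k : ℤ, k • B.omega = P.wtP c) :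
    ∃ u : Path P.tQ i j, P.Shortest u := by
  obtain ⟨a, ha⟩ := hi
  obtain ⟨S, hS, -⟩ := hB (P.proj.onA a)
  obtain ⟨r⟩ := exists_return p₀
  have hdeg (p : Path P.tQ i j) : 0 ≤ BraneTiling.degree hS (P.wtP p) := by
    rw [wtP_eq_wtL, BraneTiling.degree_wtL]; exact Int.natCast_nonneg _
  obtain ⟨u, hu⟩ : ∃ u : Path P.tQ i j, ∀ p : Path P.tQ i j,
      (BraneTiling.degree hS (P.wtP u)).toNat ≤ (BraneTiling.degree hS (P.wtP p)).toNat := by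
    have : Nonempty (Path P.tQ i j) := ⟨p₀⟩
    exact ⟨_, fun p => Function.argmin_le
      (fun p : Path P.tQ i j => (BraneTiling.degree hS (P.wtP p)).toNat) p⟩
  refine ⟨u, (shortest_iff hc u).2 ⟨⟨a, ha⟩, fun p => ?_⟩⟩
  obtain ⟨k, hk⟩ := hloop (p.comp r)
  obtain ⟨l, hl⟩ := hloop (u.comp r)
  rw [wtP_comp] at hk hl
  have hkl : P.wtP p = (k - l) • B.omega + P.wtP u := by
    rw [sub_zsmul, hk, hl]; abel
  have h := congrArg (BraneTiling.degree hS) hkl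
  rw [map_add, map_zsmul, BraneTiling.degree_omega hS (P.proj.onA a), smul_eq_mul, mul_one] at h
  have := hu p
  have := hdeg p
  have := hdeg u
  refine ⟨(k - l).toNat, ?_⟩
  rw [hkl, ← natCast_zsmul, Int.toNat_of_nonneg (by omega)]

theorem exists_strict_of_shortest_extension (hB : B.NonDegenerate) (hc : B.Consistent1)
    (hs : ∀ (i j : P.tQ.V) (u : Path P.tQ i j), P.Shortest u →
      ∃ (a : P.tQ.A) (h : P.tQ.tgt a = i), P.Shortest (((Path.single a).cast rfl h).comp u))
    {i j : P.tQ.V} (w : WPath P.tQ i j)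
    (hw : ∀ (a : P.tQ.A) (h : P.tQ.tgt a = i), ∃ p : Path P.tQ (P.tQ.src a) j,
      P.WkEquiv ((((Path.single a).cast rfl h).toWeak).comp w) p.toWeak) (a₀ : P.tQ.A)
    (ha₀ : P.tQ.src a₀ = i) : ∃ p : Path P.tQ i j, P.WkEquiv w p.toWeak := by
  have hi : ∃ c : Path P.tQ i i, P.wtP c = B.omega := by
    subst ha₀; exact exists_loop_src a₀
  by_contra! hcon
  have hcon' (p : Path P.tQ i j) : P.wtW w ≠ P.wtP p := fun h =>
    hcon p (wkEquiv_of_wtW_eq hc hi h)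
  have hex : ∃ (k : ℕ) (p : Path P.tQ i j), P.wtP p = k • B.omega + P.wtW w := by
    obtain ⟨k, c, p, hcw, hp⟩ := exists_wkEquiv_strict hc w hi
    exact ⟨k, p, by rw [← wtW_toWeak, ← wtW_eq_of_wkEquiv hp, wtW_comp, wtW_toWeak, hcw]⟩
  obtain ⟨p₀, hp₀⟩ := Nat.find_spec hex
  have hmin (k : ℕ) (hk : k < Nat.find hex) := Nat.find_min hex hk
  generalize Nat.find hex = n at hp₀ hmin
  obtain _ | m := n
  · exact hcon' p₀ (by rw [hp₀, zero_smul, zero_add])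
  have hU : ∀ (x : B.Q.V) (r : Path B.Q (P.proj.onV i) x), B.wtP r ≠ P.wtP p₀ - B.omega := by
    intro x r hr
    obtain ⟨j', r', hr'⟩ := exists_lift r i rfl
    have hwt : P.wtP r' = P.wtP p₀ - B.omega := by
      rw [wtP_eq_wtL, hr', ← BraneTiling.wtP_eq_wtL, hr]
    obtain ⟨c, hcw⟩ := hi
    obtain ⟨rfl, -⟩ := wkEquiv_of_wtP_eq hc (c.comp r') p₀ (by
      rw [wtP_comp, hcw, hwt, add_sub_cancel])
    refine hmin m m.lt_succ_self ⟨r', ?_⟩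
    rw [hwt, hp₀, succ_nsmul]; abel
  have hext : ∀ a, B.Q.tgt a = P.proj.onV i → ∃ (x : B.Q.V) (v : Path B.Q (B.Q.src a) x),
      B.wtP v = P.wtP p₀ - B.omega + B.wtA a := by
    intro a ha
    obtain ⟨b, ⟨rfl, rfl⟩, -⟩ := P.liftTgt a i ha.symm
    obtain ⟨p, hp⟩ := hw b rfl
    obtain ⟨c, hcw⟩ := exists_loop (exists_loop_src b) m
    refine ⟨_, ((c.comp p).map P.proj).cast (P.proj.src_comm b).symm rfl, ?_⟩
    rw [BraneTiling.wtP_cast]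
    change P.wtP (c.comp p) = _
    rw [wtP_comp, hcw, ← wtW_toWeak p, ← wtW_eq_of_wkEquiv hp, wtW_comp, wtW_toWeak, hp₀,
      succ_nsmul]
    change _ + (P.wtP (.single b) + _) = _
    rw [wtP_single]; abel
  obtain ⟨b, hb⟩ := (P.twface true a₀).exists_tgt_eq ⟨a₀, rfl⟩
  have hbi : B.Q.tgt (P.proj.onA b) = P.proj.onV i := by rw [P.proj.tgt_comm, hb, ha₀]
  obtain ⟨u, hu⟩ := exists_shortest_of_loops hB hc ⟨a₀, ha₀⟩ p₀ fun c =>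
    BraneTiling.exists_zsmul_omega_of_not_extendable hB hc hU hext hbi (c.map P.proj)
  obtain ⟨a, rfl, hau⟩ := hs i j u hu
  obtain ⟨p, hp⟩ := hw a rfl
  obtain ⟨k, hk⟩ := ((shortest_iff hc _).1 hau).2 p
  obtain ⟨c, hcw⟩ := exists_loop hi k
  refine hcon' (c.comp u) ?_
  rw [← wtW_toWeak p, ← wtW_eq_of_wkEquiv hp, wtW_comp, wtW_toWeak, wtP_comp] at hk
  change P.wtP (.single a) + _ = _ + (P.wtP (.single a) + _) at hk
  rw [wtP_comp, hcw, ← add_right_inj (P.wtP (.single a)), hk]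
  abel

end Periodic

/-- Let `(Q, W)` arise from a non-degenerate brane tiling
satisfying the first consistency condition, with periodic quiver `Q̃`.  Then
the following conditions are equivalent: (1) for every shortest path `u` in
`Q̃` (between its endpoints) there exists an arrow `a` with `t(a) = s(u)` such
that `ua` is also a shortest path; (2) if `w` is a weak path in `Q̃` such that
`wa` is weakly equivalent to a strict path for every arrow `a` with
`t(a) = s(w)`, then `w` itself is weakly equivalent to a strict path. -/
theorem shortest_extension_iff_weakly_strict (B : BraneTiling)
    (hB : B.NonDegenerate) (hc : B.Consistent1) (P : Periodic B) :
    (∀ (i j : P.tQ.V) (u : Path P.tQ i j), P.Shortest u →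
      ∃ (a : P.tQ.A) (h : P.tQ.tgt a = i),
        P.Shortest (((Path.single a).cast rfl h).comp u)) ↔
    (∀ (i j : P.tQ.V) (w : Quiv.WPath P.tQ i j),
      (∀ (a : P.tQ.A) (h : P.tQ.tgt a = i),
        ∃ p : Path P.tQ (P.tQ.src a) j,
          P.WkEquiv ((((Path.single a).cast rfl h).toWeak).comp w) p.toWeak) →
      ∃ p : Path P.tQ i j, P.WkEquiv w p.toWeak) := by
  refine ⟨fun hs i j w hw => ?_, fun hw i j u hu =>
    Periodic.exists_shortest_extension hB hc hw hu⟩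
  cases w with
  | nil => exact ⟨.nil i, .refl _⟩
  | fwd a w => exact Periodic.exists_strict_of_shortest_extension hB hc hs _ hw a rfl
  | bwd a w =>
    obtain ⟨b, hb⟩ := (P.twface true a).exists_src_eq ⟨a, rfl⟩
    exact Periodic.exists_strict_of_shortest_extension hB hc hs _ hw b hb
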